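/- arXiv:2506.02042 — 4 statements merged into one kernel-verified Lean document; each statement's English description precedes it below -/
import Mathlib

section
/- Let N be a unitarily invariant norm on the n×n complex matrices and let α ∈ [0, π/2). If X ∈ M_n has numerical range W(X) contained in the sector S_α, then ω_N(Im(X)) ≤ tan(α) · ω_N(Re(X)). -/
open scoped ComplexOrder Matrix

/-- The Hermitian (real) part of a matrix: `Re(X) = (X + X*)/2`. -/
noncomputable def matRe {n : ℕ} (X : Matrix (Fin n) (Fin n) ℂ) :
    Matrix (Fin n) (Fin n) ℂ :=
  (1 / 2 : ℂ) • (X + Xᴴ)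

/-- The skew (imaginary) part of a matrix: `Im(X) = (X - X*)/(2i)`. -/
noncomputable def matIm {n : ℕ} (X : Matrix (Fin n) (Fin n) ℂ) :
    Matrix (Fin n) (Fin n) ℂ :=
  (1 / (2 * Complex.I)) • (X - Xᴴ)

/-- The generalized numerical radius induced by a norm `N`:
`ω_N(X) = sup_θ N(Re(e^{iθ} X))`. -/
noncomputable def gnr {n : ℕ} (N : Matrix (Fin n) (Fin n) ℂ → ℝ)
    (X : Matrix (Fin n) (Fin n) ℂ) : ℝ :=
  ⨆ θ : ℝ, N (matRe (Complex.exp (θ * Complex.I) • X))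

/-- The numerical range `W(X) = {⟨Xx, x⟩ : ‖x‖ = 1}` (standard inner product on ℂⁿ). -/
def numRange {n : ℕ} (X : Matrix (Fin n) (Fin n) ℂ) : Set ℂ :=
  { z | ∃ x : Fin n → ℂ, star x ⬝ᵥ x = 1 ∧ z = star x ⬝ᵥ X.mulVec x }

/-- The sector `S_α = {z : Re z > 0, |Im z| ≤ tan(α) Re z}`. -/
def sector (α : ℝ) : Set ℂ :=
  { z | 0 < z.re ∧ |z.im| ≤ Real.tan α * z.re }

/-- The class `M^s_{n,α}` of matrices `X` such that `W(zX) ⊆ S_α` for some unimodular `z`. -/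
def sectClass (n : ℕ) (α : ℝ) : Set (Matrix (Fin n) (Fin n) ℂ) :=
  { X | ∃ z : ℂ, ‖z‖ = 1 ∧ numRange (z • X) ⊆ sector α }

section helpers

variable {n : ℕ} (N : Matrix (Fin n) (Fin n) ℂ → ℝ)

theorem aux_diag_unitary (u : Fin n → ℂ) (hu : ∀ i, star (u i) * u i = 1) :
    Matrix.diagonal u ∈ Matrix.unitaryGroup (Fin n) ℂ := by
  rw [Matrix.mem_unitaryGroup_iff', Matrix.star_eq_conjTranspose, Matrix.diagonal_conjTranspose,
    Matrix.diagonal_mul_diagonal, ← Matrix.diagonal_one]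
  congr 1
  funext i
  exact hu i

theorem aux_signs (i j : Fin n) (hij : i ≠ j) :
    ∑ s : Fin n → ℤˣ, (((s i : ℤ) : ℂ) * ((s j : ℤ) : ℂ)) = 0 := by
  have h := Equiv.sum_comp (Equiv.mulRight (Function.update (1 : Fin n → ℤˣ) i (-1)))
    (fun s : Fin n → ℤˣ => (((s i : ℤ) : ℂ) * ((s j : ℤ) : ℂ)))
  simp [Function.update_of_ne hij.symm, Finset.sum_neg_distrib] at h
  have h2 := h
  exact self_eq_neg.mp h2.symm

theorem aux_sign_sq (e : ℤˣ) : (((e : ℤ) : ℂ) * ((e : ℤ) : ℂ)) = 1 := by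
  rcases Int.units_eq_one_or e with h | h <;> simp [h]

theorem aux_pinch
    (hNs : ∀ (c : ℂ) (A : Matrix (Fin n) (Fin n) ℂ), N (c • A) = ‖c‖ * N A)
    (hNa : ∀ A B : Matrix (Fin n) (Fin n) ℂ, N (A + B) ≤ N A + N B)
    (hUI : ∀ U V A : Matrix (Fin n) (Fin n) ℂ, U ∈ Matrix.unitaryGroup (Fin n) ℂ →
      V ∈ Matrix.unitaryGroup (Fin n) ℂ → N (U * A * V) = N A)
    (A : Matrix (Fin n) (Fin n) ℂ) :
    N (Matrix.diagonal fun i => A i i) ≤ N A := by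
  have h0 : N 0 = 0 := by simpa using hNs 0 0
  let D : (Fin n → ℤˣ) → Matrix (Fin n) (Fin n) ℂ :=
    fun s => Matrix.diagonal fun i => ((s i : ℤ) : ℂ)
  have hD : ∀ s, D s ∈ Matrix.unitaryGroup (Fin n) ℂ := by
    intro s
    apply aux_diag_unitary
    intro i
    simpa using aux_sign_sq (s i)
  set K : ℕ := Fintype.card (Fin n → ℤˣ) with hK
  have hKpos : 0 < K := Fintype.card_pos
  have key : (K : ℂ) • (Matrix.diagonal fun i => A i i) = ∑ s, D s * A * D s := by
    ext i j
    rw [Matrix.sum_apply]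
    simp only [D, Matrix.mul_diagonal, Matrix.diagonal_mul, Matrix.smul_apply, smul_eq_mul]
    have e : ∀ s : Fin n → ℤˣ, ((s i : ℤ) : ℂ) * A i j * ((s j : ℤ) : ℂ)
        = (((s i : ℤ) : ℂ) * ((s j : ℤ) : ℂ)) * A i j := fun s => by ring
    rw [Finset.sum_congr rfl fun s _ => e s, ← Finset.sum_mul]
    by_cases hij : i = j
    · subst hij
      rw [Finset.sum_congr rfl fun s _ => aux_sign_sq (s i)]
      rw [Matrix.diagonal_apply_eq, Finset.sum_const, Finset.card_univ, nsmul_eq_mul, mul_one]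
    · rw [aux_signs i j hij, Matrix.diagonal_apply_ne _ hij]
      simp
  have hle : N (∑ s, D s * A * D s) ≤ ∑ s, N (D s * A * D s) :=
    Finset.le_sum_of_subadditive N h0.le hNa _ _
  rw [← key, hNs, Finset.sum_congr rfl fun s _ => hUI _ _ A (hD s) (hD s), Finset.sum_const,
    Finset.card_univ, nsmul_eq_mul, Complex.norm_natCast] at hle
  exact le_of_mul_le_mul_left hle (by exact_mod_cast hKpos)

theorem aux_contr
    (hNs : ∀ (c : ℂ) (A : Matrix (Fin n) (Fin n) ℂ), N (c • A) = ‖c‖ * N A)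
    (hNa : ∀ A B : Matrix (Fin n) (Fin n) ℂ, N (A + B) ≤ N A + N B)
    (hUI : ∀ U V A : Matrix (Fin n) (Fin n) ℂ, U ∈ Matrix.unitaryGroup (Fin n) ℂ →
      V ∈ Matrix.unitaryGroup (Fin n) ℂ → N (U * A * V) = N A)
    (A : Matrix (Fin n) (Fin n) ℂ) (c : Fin n → ℝ) (hc : ∀ i, |c i| ≤ 1) :
    N ((Matrix.diagonal fun i => (c i : ℂ)) * A) ≤ N A := by
  let u : Fin n → ℂ := fun i => ⟨c i, √(1 - c i ^ 2)⟩
  have hs : ∀ i, √(1 - c i ^ 2) * √(1 - c i ^ 2) = 1 - c i ^ 2 := by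
    intro i
    apply Real.mul_self_sqrt
    have := (sq_le_one_iff_abs_le_one (c i)).2 (hc i)
    linarith
  have hu : ∀ i, star (u i) * u i = 1 := by
    intro i
    apply Complex.ext
    · simp [u, hs]; ring
    · simp [u]; ring
  have hu' : ∀ i, star (star (u i)) * star (u i) = 1 := by
    intro i
    rw [star_star, mul_comm]; exact hu i
  have e : (Matrix.diagonal fun i => (c i : ℂ)) * A
      = (1/2 : ℂ) • (Matrix.diagonal u * A * 1 + Matrix.diagonal (fun i => star (u i)) * A * 1) := by
    rw [mul_one, mul_one, ← add_mul, Matrix.diagonal_add, ← Matrix.smul_mul, ← Matrix.diagonal_smul]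
    congr 2
    funext i
    apply Complex.ext <;> simp [u] ; ring
  rw [e, hNs]
  have h1 := hNa (Matrix.diagonal u * A * 1) (Matrix.diagonal (fun i => star (u i)) * A * 1)
  rw [hUI _ _ A (aux_diag_unitary u hu) (one_mem _),
    hUI _ _ A (aux_diag_unitary _ hu') (one_mem _)] at h1
  have h2 : ‖(1 / 2 : ℂ)‖ = 1 / 2 := by norm_num
  rw [h2]
  linarith

theorem aux_matRe_herm (X : Matrix (Fin n) (Fin n) ℂ) : (matRe X)ᴴ = matRe X := by
  ext i j
  simp [matRe]; ring

theorem aux_matIm_herm (X : Matrix (Fin n) (Fin n) ℂ) : (matIm X)ᴴ = matIm X := by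
  ext i j
  simp [matIm]; ring

theorem aux_rot (A : Matrix (Fin n) (Fin n) ℂ) (hA : Aᴴ = A) (θ : ℝ) :
    matRe (Complex.exp (θ * Complex.I) • A) = (Real.cos θ : ℂ) • A := by
  rw [matRe, Matrix.conjTranspose_smul, hA, ← add_smul, smul_smul]
  congr 1
  rw [Complex.star_def, ← Complex.exp_conj, Complex.ofReal_cos, Complex.cos]
  simp
  ring

theorem aux_diag_case
    (hNs : ∀ (c : ℂ) (A : Matrix (Fin n) (Fin n) ℂ), N (c • A) = ‖c‖ * N A)
    (hNa : ∀ A B : Matrix (Fin n) (Fin n) ℂ, N (A + B) ≤ N A + N B)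
    (hUI : ∀ U V A : Matrix (Fin n) (Fin n) ℂ, U ∈ Matrix.unitaryGroup (Fin n) ℂ →
      V ∈ Matrix.unitaryGroup (Fin n) ℂ → N (U * A * V) = N A)
    {α : ℝ} (ht : 0 ≤ Real.tan α) (Y : Matrix (Fin n) (Fin n) ℂ)
    (hY : ∀ i, Y i i ∈ sector α) (d : Fin n → ℂ) (hd : matIm Y = Matrix.diagonal d) :
    N (matIm Y) ≤ Real.tan α * N (matRe Y) := by
  have hdi : ∀ i, d i = ((Y i i).im : ℂ) := by
    intro i
    have h := congrFun (congrFun hd i) i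
    rw [Matrix.diagonal_apply_eq] at h
    rw [← h]
    apply Complex.ext <;> simp [matIm] <;> ring
  have hai : ∀ i, matRe Y i i = ((Y i i).re : ℂ) := by
    intro i
    apply Complex.ext <;> simp [matRe] ; ring
  let c : Fin n → ℝ := fun i => (Y i i).im / (Real.tan α * (Y i i).re)
  have hc : ∀ i, |c i| ≤ 1 := by
    intro i
    obtain ⟨h1, h2⟩ := hY i
    have h3 : 0 ≤ Real.tan α * (Y i i).re := mul_nonneg ht h1.le
    simp only [c]
    rw [abs_div, abs_of_nonneg h3]
    exact div_le_one_of_le₀ h2 h3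
  have hci : ∀ i, (Y i i).im = c i * (Real.tan α * (Y i i).re) := by
    intro i
    obtain ⟨h1, h2⟩ := hY i
    by_cases h : Real.tan α * (Y i i).re = 0
    · rw [h] at h2 ⊢
      simpa using h2
    · simp only [c]
      rw [div_mul_cancel₀ _ h]
  have e : matIm Y = (Matrix.diagonal fun i => (c i : ℂ)) *
      ((Real.tan α : ℂ) • Matrix.diagonal fun i => matRe Y i i) := by
    rw [hd, ← Matrix.diagonal_smul, Matrix.diagonal_mul_diagonal]
    congr 1
    funext i
    rw [hdi, hci, Pi.smul_apply, hai, smul_eq_mul]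
    push_cast
    ring
  rw [e]
  refine (aux_contr N hNs hNa hUI _ c hc).trans ?_
  rw [hNs, Complex.norm_real, Real.norm_of_nonneg ht]
  exact mul_le_mul_of_nonneg_left (aux_pinch N hNs hNa hUI _) ht

theorem aux_main
    (hNs : ∀ (c : ℂ) (A : Matrix (Fin n) (Fin n) ℂ), N (c • A) = ‖c‖ * N A)
    (hNa : ∀ A B : Matrix (Fin n) (Fin n) ℂ, N (A + B) ≤ N A + N B)
    (hUI : ∀ U V A : Matrix (Fin n) (Fin n) ℂ, U ∈ Matrix.unitaryGroup (Fin n) ℂ →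
      V ∈ Matrix.unitaryGroup (Fin n) ℂ → N (U * A * V) = N A)
    {α : ℝ} (ht : 0 ≤ Real.tan α) (X : Matrix (Fin n) (Fin n) ℂ)
    (hX : numRange X ⊆ sector α) :
    N (matIm X) ≤ Real.tan α * N (matRe X) := by
  have hB : (matIm X).IsHermitian := aux_matIm_herm X
  obtain ⟨U, hU, d, hd⟩ : ∃ U ∈ Matrix.unitaryGroup (Fin n) ℂ, ∃ d : Fin n → ℂ,
      matIm X = U * Matrix.diagonal d * Uᴴ := by
    refine ⟨hB.eigenvectorUnitary, hB.eigenvectorUnitary.2, fun i => (hB.eigenvalues i : ℂ), ?_⟩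
    have := hB.spectral_theorem
    rw [Unitary.conjStarAlgAut_apply] at this
    exact this
  have hU1 : Uᴴ * U = 1 := Matrix.mem_unitaryGroup_iff'.1 hU
  have hU' : Uᴴ ∈ Matrix.unitaryGroup (Fin n) ℂ := by
    rw [Matrix.mem_unitaryGroup_iff, Matrix.star_eq_conjTranspose, Matrix.conjTranspose_conjTranspose]
    exact hU1
  have eI : matIm (Uᴴ * X * U) = Uᴴ * matIm X * U := by
    simp [matIm, Matrix.conjTranspose_mul, mul_sub, sub_mul, mul_assoc]
  have eR : matRe (Uᴴ * X * U) = Uᴴ * matRe X * U := by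
    simp [matRe, Matrix.conjTranspose_mul, mul_add, add_mul, mul_assoc]
  rw [← hUI _ _ (matIm X) hU' hU, ← hUI _ _ (matRe X) hU' hU, ← eI, ← eR]
  refine aux_diag_case N hNs hNa hUI ht _ ?_ d ?_
  · intro i
    apply hX
    refine ⟨fun k => U k i, ?_, ?_⟩
    · have := congrFun (congrFun hU1 i) i
      rw [Matrix.one_apply_eq] at this
      rw [← this]
      rfl
    · rw [mul_assoc, Matrix.mul_apply]
      rfl
  · rw [eI, hd]
    calc Uᴴ * (U * Matrix.diagonal d * Uᴴ) * U
        = (Uᴴ * U) * Matrix.diagonal d * (Uᴴ * U) := by simp only [mul_assoc]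
      _ = _ := by rw [hU1, one_mul, mul_one]

end helpers

theorem stmt_1 {n : ℕ} (N : Matrix (Fin n) (Fin n) ℂ → ℝ)
    (hN0 : ∀ A : Matrix (Fin n) (Fin n) ℂ, N A = 0 ↔ A = 0)
    (hNs : ∀ (c : ℂ) (A : Matrix (Fin n) (Fin n) ℂ), N (c • A) = ‖c‖ * N A)
    (hNa : ∀ A B : Matrix (Fin n) (Fin n) ℂ, N (A + B) ≤ N A + N B)
    (hUI : ∀ U V A : Matrix (Fin n) (Fin n) ℂ, U ∈ Matrix.unitaryGroup (Fin n) ℂ →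
      V ∈ Matrix.unitaryGroup (Fin n) ℂ → N (U * A * V) = N A)
    {α : ℝ} (hα0 : 0 ≤ α) (hα1 : α < Real.pi / 2)
    (X : Matrix (Fin n) (Fin n) ℂ) (hX : numRange X ⊆ sector α) :
    gnr N (matIm X) ≤ Real.tan α * gnr N (matRe X) := by
  have hN : ∀ A, 0 ≤ N A := by
    intro A
    have h1 := hNa A ((-1 : ℂ) • A)
    rw [hNs] at h1
    have h2 : N (A + (-1 : ℂ) • A) = 0 := by
      rw [hN0]; simp
    rw [h2] at h1
    norm_num at h1
    exact h1
  have ht : 0 ≤ Real.tan α := Real.tan_nonneg_of_nonneg_of_le_pi_div_two hα0 hα1.le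
  have hle : ∀ A : Matrix (Fin n) (Fin n) ℂ, Aᴴ = A → ∀ θ : ℝ,
      N (matRe (Complex.exp (θ * Complex.I) • A)) ≤ N A := by
    intro A hA θ
    rw [aux_rot A hA, hNs, Complex.norm_real]
    exact mul_le_of_le_one_left (hN A) (Real.abs_cos_le_one θ)
  have hR : N (matRe X) ≤ gnr N (matRe X) := by
    have hb : BddAbove (Set.range fun θ : ℝ =>
        N (matRe (Complex.exp (θ * Complex.I) • matRe X))) :=
      ⟨N (matRe X), by rintro _ ⟨θ, rfl⟩; exact hle _ (aux_matRe_herm X) θ⟩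
    have h := le_ciSup hb 0
    have e := aux_rot (matRe X) (aux_matRe_herm X) 0
    simp only [e, Real.cos_zero, Complex.ofReal_one, one_smul] at h
    exact h
  have hI : gnr N (matIm X) ≤ N (matIm X) := ciSup_le (hle _ (aux_matIm_herm X))
  exact hI.trans ((aux_main N hNs hNa hUI ht X hX).trans (mul_le_mul_of_nonneg_left hR ht))
end

section
/- Let N be a submultiplicative, unitarily invariant norm on the n×n complex matrices and let α ∈ [0, π/2). If X, Y ∈ M^s_{n,α}, then ω_N(XY) ≤ sec²(α)·ω_N(X)·ω_N(Y). -/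
open scoped ComplexOrder Matrix

theorem aux_spec {n : ℕ} {M : Matrix (Fin n) (Fin n) ℂ} (hM : M.PosDef) :
    ∃ U : Matrix (Fin n) (Fin n) ℂ, ∃ d : Fin n → ℝ, Uᴴ * U = 1 ∧ U * Uᴴ = 1 ∧
      (∀ i, 0 < d i) ∧ M = U * Matrix.diagonal (fun i => (d i : ℂ)) * Uᴴ := by
  refine ⟨hM.1.eigenvectorUnitary, hM.1.eigenvalues, ?_, ?_, hM.eigenvalues_pos, ?_⟩
  · exact Unitary.coe_star_mul_self hM.1.eigenvectorUnitary
  · exact Unitary.coe_mul_star_self hM.1.eigenvectorUnitary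
  · conv_lhs => rw [hM.1.spectral_theorem, Unitary.conjStarAlgAut_apply]
    rfl

theorem aux_diag {n : ℕ} {U : Matrix (Fin n) (Fin n) ℂ} (h : Uᴴ * U = 1) (a b : Fin n → ℂ) :
    (U * Matrix.diagonal a * Uᴴ) * (U * Matrix.diagonal b * Uᴴ)
      = U * Matrix.diagonal (fun i => a i * b i) * Uᴴ := by
  have : (U * Matrix.diagonal a * Uᴴ) * (U * Matrix.diagonal b * Uᴴ)
      = U * Matrix.diagonal a * (Uᴴ * U) * Matrix.diagonal b * Uᴴ := by
    simp only [Matrix.mul_assoc]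
  rw [this, h, Matrix.mul_one, Matrix.mul_assoc U, Matrix.diagonal_mul_diagonal]

theorem aux_diagH {n : ℕ} (U : Matrix (Fin n) (Fin n) ℂ) (a : Fin n → ℂ) :
    (U * Matrix.diagonal a * Uᴴ)ᴴ = U * Matrix.diagonal (star a) * Uᴴ := by
  simp [Matrix.conjTranspose_mul, Matrix.diagonal_conjTranspose, Matrix.mul_assoc]

theorem aux_posdef_diag {n : ℕ} {U : Matrix (Fin n) (Fin n) ℂ} (h : U * Uᴴ = 1)
    (d : Fin n → ℝ) (hd : ∀ i, 0 < d i) :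
    (U * Matrix.diagonal (fun i => (d i : ℂ)) * Uᴴ).PosDef := by
  have hD : (Matrix.diagonal (fun i => (d i : ℂ))).PosDef :=
    Matrix.PosDef.diagonal (fun i => by simpa using hd i)
  have hU : IsUnit U := IsUnit.of_mul_eq_one _ h
  exact (Matrix.IsUnit.posDef_star_right_conjugate_iff hU).2 hD

/-- positive definite square root -/
theorem aux_sqrt {n : ℕ} {M : Matrix (Fin n) (Fin n) ℂ} (hM : M.PosDef) :
    ∃ S : Matrix (Fin n) (Fin n) ℂ, S.PosDef ∧ S * S = M := by
  obtain ⟨U, d, h1, h2, hd, rfl⟩ := aux_spec hM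
  refine ⟨U * Matrix.diagonal (fun i => ((Real.sqrt (d i) : ℝ) : ℂ)) * Uᴴ,
    aux_posdef_diag h2 _ (fun i => Real.sqrt_pos.2 (hd i)), ?_⟩
  rw [aux_diag h1]
  congr 3
  ext i
  rw [← Complex.ofReal_mul, Real.mul_self_sqrt (hd i).le]

theorem aux_mem {n : ℕ} {U : Matrix (Fin n) (Fin n) ℂ} (h : Uᴴ * U = 1) :
    U ∈ Matrix.unitaryGroup (Fin n) ℂ := by
  rw [Matrix.mem_unitaryGroup_iff']; exact h

theorem aux_posdef_self {n : ℕ} {A : Matrix (Fin n) (Fin n) ℂ} (hA : IsUnit A) :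
    (Aᴴ * A).PosDef := by
  have := (Matrix.IsUnit.posDef_star_left_conjugate_iff (x := 1) hA).2 Matrix.PosDef.one
  rw [Matrix.mul_one] at this
  exact this

theorem aux_polar {n : ℕ} {A : Matrix (Fin n) (Fin n) ℂ} (hA : IsUnit A) :
    ∃ W P : Matrix (Fin n) (Fin n) ℂ, Wᴴ * W = 1 ∧ P.PosDef ∧ A = W * P := by
  obtain ⟨P, hP, hPP⟩ := aux_sqrt (aux_posdef_self hA)
  have hu := (Matrix.isUnit_iff_isUnit_det P).1 hP.isUnit
  refine ⟨A * P⁻¹, P, ?_, hP, ?_⟩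
  · rw [Matrix.conjTranspose_mul, Matrix.conjTranspose_nonsing_inv, hP.1.eq]
    have : P⁻¹ * Aᴴ * (A * P⁻¹) = P⁻¹ * (Aᴴ * A) * P⁻¹ := by simp only [Matrix.mul_assoc]
    rw [this, ← hPP, ← Matrix.mul_assoc, Matrix.nonsing_inv_mul _ hu, Matrix.one_mul,
      Matrix.mul_nonsing_inv _ hu]
  · rw [Matrix.mul_assoc, Matrix.nonsing_inv_mul _ hu, Matrix.mul_one]

theorem aux_contr_s4 {n : ℕ} {K : Matrix (Fin n) (Fin n) ℂ} (hK : IsUnit K)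
    (h : (1 - Kᴴ * K).PosSemidef) :
    ∃ V₁ V₂ : Matrix (Fin n) (Fin n) ℂ, V₁ᴴ * V₁ = 1 ∧ V₂ᴴ * V₂ = 1 ∧
      K = (1 / 2 : ℂ) • (V₁ + V₂) := by
  obtain ⟨W, P, hW, hP, rfl⟩ := aux_polar hK
  obtain ⟨U, d, h1, h2, hd, rfl⟩ := aux_spec hP
  have hd1 : ∀ i, d i * d i ≤ 1 := by
    have e : 1 - (W * (U * Matrix.diagonal (fun i => (d i : ℂ)) * Uᴴ))ᴴ *
        (W * (U * Matrix.diagonal (fun i => (d i : ℂ)) * Uᴴ)) =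
        U * Matrix.diagonal (fun i => ((1 - d i * d i : ℝ) : ℂ)) * star U := by
      rw [Matrix.conjTranspose_mul, aux_diagH, Matrix.mul_assoc _ Wᴴ, ← Matrix.mul_assoc Wᴴ,
        hW, Matrix.one_mul, aux_diag h1]
      have : (fun i => ((1 - d i * d i : ℝ) : ℂ)) =
        fun i => (1 : ℂ) - (star (fun i => (d i : ℂ)) : Fin n → ℂ) i * d i := by
        ext i; simp
      rw [this, ← Matrix.diagonal_sub, Matrix.mul_sub, Matrix.sub_mul, Matrix.diagonal_one,
        Matrix.mul_one, Matrix.star_eq_conjTranspose, h2]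
    rw [e, Matrix.IsUnit.posSemidef_star_right_conjugate_iff (IsUnit.of_mul_eq_one _ h2),
      Matrix.posSemidef_diagonal_iff] at h
    intro i
    have := h i
    rw [Complex.zero_le_real] at this
    linarith
  have key : ∀ s : ℝ, s * s = 1 → ∀ V : Matrix (Fin n) (Fin n) ℂ,
      V = W * (U * Matrix.diagonal (fun i => (d i : ℂ) +
        ((s * Real.sqrt (1 - d i * d i) : ℝ) : ℂ) * Complex.I) * Uᴴ) → Vᴴ * V = 1 := by
    rintro s hs V rfl
    rw [Matrix.conjTranspose_mul, aux_diagH, Matrix.mul_assoc _ Wᴴ, ← Matrix.mul_assoc Wᴴ,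
      hW, Matrix.one_mul, aux_diag h1]
    have : (fun i => (star (fun i => (d i : ℂ) +
        ((s * Real.sqrt (1 - d i * d i) : ℝ) : ℂ) * Complex.I) : Fin n → ℂ) i * ((d i : ℂ) +
        ((s * Real.sqrt (1 - d i * d i) : ℝ) : ℂ) * Complex.I)) = fun _ => 1 := by
      ext i
      have hq := Real.mul_self_sqrt (sub_nonneg.2 (hd1 i))
      simp only [Pi.star_apply]
      apply Complex.ext
      · simp
        linear_combination hs * (Real.sqrt (1 - d i * d i) * Real.sqrt (1 - d i * d i)) + hq
      · simp; ring
    rw [this, Matrix.diagonal_one, Matrix.mul_one, h2]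
  refine ⟨_, _, key 1 (by norm_num) _ rfl, key (-1) (by norm_num) _ rfl, ?_⟩
  rw [← Matrix.mul_add, ← Matrix.add_mul, ← Matrix.mul_add, Matrix.diagonal_add,
    ← Matrix.mul_smul, ← Matrix.smul_mul, ← Matrix.mul_smul, ← Matrix.diagonal_smul]
  congr 4
  ext i
  simp
  ring

theorem aux_mono {n : ℕ} (N : Matrix (Fin n) (Fin n) ℂ → ℝ)
    (hNs : ∀ (c : ℂ) (A : Matrix (Fin n) (Fin n) ℂ), N (c • A) = ‖c‖ * N A)
    (hNa : ∀ A B : Matrix (Fin n) (Fin n) ℂ, N (A + B) ≤ N A + N B)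
    (hUI : ∀ U V A : Matrix (Fin n) (Fin n) ℂ, U ∈ Matrix.unitaryGroup (Fin n) ℂ →
      V ∈ Matrix.unitaryGroup (Fin n) ℂ → N (U * A * V) = N A)
    {P Q : Matrix (Fin n) (Fin n) ℂ} (hP : P.PosDef) (hQ : Q.PosDef)
    (hPQ : (Q - P).PosSemidef) : N P ≤ N Q := by
  obtain ⟨S, hS, rfl⟩ := aux_sqrt hP
  obtain ⟨R, hR, rfl⟩ := aux_sqrt hQ
  have hu := (Matrix.isUnit_iff_isUnit_det R).1 hR.isUnit
  have hRi : (R⁻¹)ᴴ = R⁻¹ := by rw [Matrix.conjTranspose_nonsing_inv, hR.1.eq]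
  have hRu : IsUnit R⁻¹ := hR.inv.isUnit
  have e1 : R⁻¹ * R = 1 := Matrix.nonsing_inv_mul _ hu
  have e2 : R * R⁻¹ = 1 := Matrix.mul_nonsing_inv _ hu
  have hKH : (S * R⁻¹)ᴴ = R⁻¹ * S := by rw [Matrix.conjTranspose_mul, hRi, hS.1.eq]
  have hc : (1 - (S * R⁻¹)ᴴ * (S * R⁻¹)).PosSemidef := by
    have := hPQ.mul_mul_conjTranspose_same R⁻¹
    convert this using 1
    rw [hKH, hRi, Matrix.mul_sub, Matrix.sub_mul]
    congr 1
    · rw [← Matrix.mul_assoc, e1, Matrix.one_mul, e2]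
    · simp only [Matrix.mul_assoc]
  obtain ⟨V₁, V₂, hV1, hV2, hK⟩ := aux_contr_s4 (hS.isUnit.mul hRu) hc
  have hKH2 : R⁻¹ * S = (1 / 2 : ℂ) • (V₁ᴴ + V₂ᴴ) := by
    rw [← hKH, hK]; simp
  have hSS : S * S = (S * R⁻¹) * (R * R) * (R⁻¹ * S) := by
    have : (S * R⁻¹) * (R * R) * (R⁻¹ * S) = S * (R⁻¹ * R) * (R * R⁻¹) * S := by
      simp only [Matrix.mul_assoc]
    rw [this, e1, e2, Matrix.mul_one, Matrix.mul_one]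
  rw [hSS, hK, hKH2]
  have hh : ‖(1 / 2 : ℂ)‖ = 1 / 2 := by norm_num
  have m1 := aux_mem hV1
  have m2 := aux_mem hV2
  have m1' : V₁ᴴ ∈ Matrix.unitaryGroup (Fin n) ℂ := Unitary.star_mem m1
  have m2' : V₂ᴴ ∈ Matrix.unitaryGroup (Fin n) ℂ := Unitary.star_mem m2
  rw [Matrix.smul_mul, Matrix.smul_mul, Matrix.mul_smul, hNs, hNs, hh, Matrix.add_mul,
    Matrix.add_mul, Matrix.mul_add, Matrix.mul_add]
  generalize hG : R * R = G
  have a1 := hNa (V₁ * G * V₁ᴴ + V₁ * G * V₂ᴴ) (V₂ * G * V₁ᴴ + V₂ * G * V₂ᴴ)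
  have a2 := hNa (V₁ * G * V₁ᴴ) (V₁ * G * V₂ᴴ)
  have a3 := hNa (V₂ * G * V₁ᴴ) (V₂ * G * V₂ᴴ)
  rw [hUI _ _ _ m1 m1', hUI _ _ _ m1 m2'] at a2
  rw [hUI _ _ _ m2 m1', hUI _ _ _ m2 m2'] at a3
  linarith

theorem aux_adj {n : ℕ} (N : Matrix (Fin n) (Fin n) ℂ → ℝ)
    (hUI : ∀ U V A : Matrix (Fin n) (Fin n) ℂ, U ∈ Matrix.unitaryGroup (Fin n) ℂ →
      V ∈ Matrix.unitaryGroup (Fin n) ℂ → N (U * A * V) = N A)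
    {A : Matrix (Fin n) (Fin n) ℂ} (hA : IsUnit A) : N Aᴴ = N A := by
  obtain ⟨W, P, hW, hP, rfl⟩ := aux_polar hA
  have m := aux_mem hW
  have m' : Wᴴ ∈ Matrix.unitaryGroup (Fin n) ℂ := Unitary.star_mem m
  have h1 := hUI 1 _ P (one_mem _) m'
  have h2 := hUI _ 1 P m (one_mem _)
  rw [Matrix.one_mul] at h1
  rw [Matrix.mul_one] at h2
  rw [Matrix.conjTranspose_mul, hP.1.eq, h1, h2]

/-- quadratic form positivity of `a A + conj a A*` -/
theorem aux_form {n : ℕ} (A : Matrix (Fin n) (Fin n) ℂ) (a : ℂ) (x : Fin n → ℂ) :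
    star x ⬝ᵥ ((a • A + star a • Aᴴ) *ᵥ x) = ((2 * (a * (star x ⬝ᵥ A *ᵥ x)).re : ℝ) : ℂ) := by
  have h : star x ⬝ᵥ Aᴴ *ᵥ x = star (star x ⬝ᵥ A *ᵥ x) := by
    rw [Matrix.star_dotProduct, Matrix.star_mulVec, Matrix.conjTranspose_conjTranspose,
      Matrix.dotProduct_mulVec]
  rw [Matrix.add_mulVec, dotProduct_add, Matrix.smul_mulVec, Matrix.smul_mulVec,
    dotProduct_smul, dotProduct_smul, h]
  generalize (star x ⬝ᵥ A *ᵥ x) = q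
  apply Complex.ext <;> simp <;> ring

theorem aux_herm {n : ℕ} (A : Matrix (Fin n) (Fin n) ℂ) (a : ℂ) :
    (a • A + star a • Aᴴ).IsHermitian := by
  unfold Matrix.IsHermitian
  simp [add_comm]

theorem aux_psd {n : ℕ} (A : Matrix (Fin n) (Fin n) ℂ) (a : ℂ)
    (h : ∀ x, x ≠ 0 → 0 ≤ (a * (star x ⬝ᵥ A *ᵥ x)).re) :
    (a • A + star a • Aᴴ).PosSemidef := by
  refine Matrix.PosSemidef.of_dotProduct_mulVec_nonneg (aux_herm A a) fun x => ?_
  rw [aux_form, Complex.zero_le_real]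
  by_cases hx : x = 0
  · simp [hx]
  · linarith [h x hx]

theorem aux_pd {n : ℕ} (A : Matrix (Fin n) (Fin n) ℂ) (a : ℂ)
    (h : ∀ x, x ≠ 0 → 0 < (a * (star x ⬝ᵥ A *ᵥ x)).re) :
    (a • A + star a • Aᴴ).PosDef := by
  refine Matrix.PosDef.of_dotProduct_mulVec_pos (aux_herm A a) fun x hx => ?_
  rw [aux_form, Complex.zero_lt_real]
  linarith [h x hx]

theorem aux_range {n : ℕ} {A : Matrix (Fin n) (Fin n) ℂ} {α : ℝ}
    (hA : numRange A ⊆ sector α) (x : Fin n → ℂ) (hx : x ≠ 0) :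
    star x ⬝ᵥ A *ᵥ x ∈ sector α := by
  have hpos : 0 < star x ⬝ᵥ x := Matrix.dotProduct_star_self_pos_iff.2 hx
  obtain ⟨r, hr, hxr⟩ : ∃ r : ℝ, 0 < r ∧ star x ⬝ᵥ x = (r : ℂ) := by
    refine ⟨(star x ⬝ᵥ x).re, (Complex.lt_def.1 hpos).1, ?_⟩
    apply Complex.ext
    · simp
    · simpa using (Complex.lt_def.1 hpos).2.symm
  set c : ℝ := (Real.sqrt r)⁻¹ with hc
  have hcc : c * c * r = 1 := by
    rw [hc, ← mul_inv, Real.mul_self_sqrt hr.le, inv_mul_cancel₀ hr.ne']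
  have hform : ∀ B : Matrix (Fin n) (Fin n) ℂ, star ((c : ℂ) • x) ⬝ᵥ B *ᵥ ((c : ℂ) • x) =
      ((c * c : ℝ) : ℂ) * (star x ⬝ᵥ B *ᵥ x) := by
    intro B
    rw [star_smul, Matrix.mulVec_smul, smul_dotProduct, dotProduct_smul]
    simp [mul_assoc]
  have hm : ((c * c : ℝ) : ℂ) * (star x ⬝ᵥ A *ᵥ x) ∈ sector α := by
    apply hA
    refine ⟨(c : ℂ) • x, ?_, (hform A).symm⟩
    have := hform 1
    rw [Matrix.one_mulVec, Matrix.one_mulVec, hxr, ← Complex.ofReal_mul, hcc] at this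
    simpa using this
  have hc0 : 0 < c * c := by
    have : 0 < c := inv_pos.2 (Real.sqrt_pos.2 hr)
    positivity
  generalize (star x ⬝ᵥ A *ᵥ x) = q at hm ⊢
  obtain ⟨h1, h2⟩ := hm
  rw [Complex.re_ofReal_mul] at h1 h2
  rw [Complex.im_ofReal_mul, abs_mul, abs_of_pos hc0] at h2
  refine ⟨by exact (mul_pos_iff_of_pos_left hc0).1 h1, ?_⟩
  refine le_of_mul_le_mul_left ?_ hc0
  linarith

theorem aux_re {n : ℕ} (A : Matrix (Fin n) (Fin n) ℂ) :
    matRe A = (1 / 2 : ℂ) • A + star (1 / 2 : ℂ) • Aᴴ := by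
  simp [matRe]

theorem aux_re_pd {n : ℕ} {A : Matrix (Fin n) (Fin n) ℂ} {α : ℝ}
    (hA : numRange A ⊆ sector α) : (matRe A).PosDef := by
  rw [aux_re]
  refine aux_pd A _ fun x hx => ?_
  have := (aux_range hA x hx).1
  simp
  linarith

theorem aux_unit {n : ℕ} {A : Matrix (Fin n) (Fin n) ℂ} {α : ℝ}
    (hA : numRange A ⊆ sector α) : IsUnit A := by
  rw [← Matrix.mulVec_injective_iff_isUnit]
  intro x y hxy
  by_contra hne
  have := (aux_range hA (x - y) (sub_ne_zero.2 hne)).1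
  rw [Matrix.mulVec_sub] at this
  change A *ᵥ x = A *ᵥ y at hxy
  rw [hxy] at this
  simp at this

theorem aux_decomp {n : ℕ} {A : Matrix (Fin n) (Fin n) ℂ} {α : ℝ} (hα0 : 0 ≤ α)
    (hα1 : α < Real.pi / 2) (hA : numRange A ⊆ sector α) :
    ∃ (P₁ P₂ : Matrix (Fin n) (Fin n) ℂ) (c : ℂ), P₁.PosSemidef ∧ P₂.PosSemidef ∧
      star c * c = 1 ∧ P₁ + P₂ = matRe A ∧
      A = (((Real.cos α)⁻¹ : ℝ) : ℂ) • (c • P₁ + star c • P₂) := by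
  rcases hα0.eq_or_lt with h0 | h0
  · subst h0
    refine ⟨matRe A, 0, 1, (aux_re_pd hA).posSemidef, Matrix.PosSemidef.zero, by simp, by simp, ?_⟩
    have him : ∀ x, x ≠ 0 → (star x ⬝ᵥ A *ᵥ x).im = 0 := by
      intro x hx
      have := (aux_range hA x hx).2
      simpa using this
    have p1 := aux_psd A Complex.I (fun x hx => by simp [him x hx])
    have p2 := aux_psd A (-Complex.I) (fun x hx => by simp [him x hx])
    have e : Complex.I • A + star Complex.I • Aᴴ = 0 := by
      open scoped MatrixOrder in
      refine le_antisymm ?_ ?_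
      · rw [Matrix.le_iff]
        rw [star_neg, neg_smul, neg_smul, ← neg_add, ← zero_sub] at p2
        exact p2
      · rw [Matrix.le_iff]
        simpa using p1
    have e2 : A = Aᴴ := by
      have : Complex.I • (A - Aᴴ) = 0 := by
        rw [← e, smul_sub]; simp [sub_eq_add_neg]
      rw [smul_eq_zero] at this
      exact sub_eq_zero.1 (this.resolve_left Complex.I_ne_zero)
    simp only [Real.cos_zero, inv_one, Complex.ofReal_one, one_smul, smul_zero, add_zero, matRe]
    rw [← e2, ← two_smul ℂ A, smul_smul]
    norm_num
  · set t := Real.tan α with ht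
    have ht0 : 0 < t := Real.tan_pos_of_pos_of_lt_pi_div_two h0 hα1
    have hcos : 0 < Real.cos α := Real.cos_pos_of_mem_Ioo ⟨by linarith, hα1⟩
    have hsin : Real.sin α = t * Real.cos α := by
      rw [ht, Real.tan_mul_cos hcos.ne']
    set a : ℂ := ⟨1 / 4, -(1 / (4 * t))⟩ with ha
    have hq : ∀ x, x ≠ 0 → |(star x ⬝ᵥ A *ᵥ x).im| / t ≤ (star x ⬝ᵥ A *ᵥ x).re := by
      intro x hx
      rw [div_le_iff₀ ht0, mul_comm]
      exact (aux_range hA x hx).2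
    have p1 := aux_psd A a (fun x hx => by
      have h1 := hq x hx
      have h2 := div_le_div_of_nonneg_right (neg_abs_le (star x ⬝ᵥ A *ᵥ x).im) ht0.le
      rw [Complex.mul_re, ha]
      have : (-(1 / (4 * t))) * (star x ⬝ᵥ A *ᵥ x).im = -(1/4) * ((star x ⬝ᵥ A *ᵥ x).im / t) := by
        field_simp
      simp only [this]
      rw [neg_div] at h2
      linarith)
    have p2 := aux_psd A (star a) (fun x hx => by
      have h1 := hq x hx
      have h2 := div_le_div_of_nonneg_right (le_abs_self (star x ⬝ᵥ A *ᵥ x).im) ht0.le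
      have h3 := div_le_div_of_nonneg_right (neg_abs_le (star x ⬝ᵥ A *ᵥ x).im) ht0.le
      rw [Complex.mul_re, ha]
      have : (-(-(1 / (4 * t)))) * (star x ⬝ᵥ A *ᵥ x).im = (1/4) * ((star x ⬝ᵥ A *ᵥ x).im / t) := by
        field_simp
      simp only [RCLike.star_def, Complex.conj_re, Complex.conj_im, this]
      rw [neg_div] at h3
      linarith)
    rw [star_star] at p2
    refine ⟨_, _, ⟨Real.cos α, Real.sin α⟩, p1, p2, ?_, ?_, ?_⟩
    · apply Complex.ext
      · simp; nlinarith [Real.sin_sq_add_cos_sq α]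
      · simp; ring
    · rw [aux_re]
      have e1 : a + star a = 1 / 2 := by
        apply Complex.ext <;> simp [ha]; norm_num
      have : a • A + star a • Aᴴ + (star a • A + a • Aᴴ) =
        (a + star a) • A + (a + star a) • Aᴴ := by module
      rw [this, e1]
      simp
    · rw [hsin]
      set c : ℂ := ⟨Real.cos α, t * Real.cos α⟩ with hc
      set s : ℂ := (((Real.cos α)⁻¹ : ℝ) : ℂ) with hs
      have : s • (c • (a • A + star a • Aᴴ) + star c • (star a • A + a • Aᴴ)) =
        (s * (c * a + star c * star a)) • A + (s * (c * star a + star c * a)) • Aᴴ := by module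
      rw [this]
      have e1 : s * (c * a + star c * star a) = 1 := by
        apply Complex.ext
        · rw [hs, hc, ha]
          generalize Real.cos α = k at hcos
          simp; field_simp; norm_num
        · simp [hs, hc, ha]; right; ring
      have e2 : s * (c * star a + star c * a) = 0 := by
        apply Complex.ext
        · simp [hs, hc, ha]; right; field_simp; norm_num
        · simp [hs, hc, ha]; right; ring
      rw [e1, e2]
      simp

theorem aux_key {n : ℕ} (N : Matrix (Fin n) (Fin n) ℂ → ℝ)
    (hNs : ∀ (c : ℂ) (A : Matrix (Fin n) (Fin n) ℂ), N (c • A) = ‖c‖ * N A)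
    (hNa : ∀ A B : Matrix (Fin n) (Fin n) ℂ, N (A + B) ≤ N A + N B)
    (hUI : ∀ U V A : Matrix (Fin n) (Fin n) ℂ, U ∈ Matrix.unitaryGroup (Fin n) ℂ →
      V ∈ Matrix.unitaryGroup (Fin n) ℂ → N (U * A * V) = N A)
    {A : Matrix (Fin n) (Fin n) ℂ} {α : ℝ} (hα0 : 0 ≤ α)
    (hα1 : α < Real.pi / 2) (hA : numRange A ⊆ sector α) :
    N A ≤ (Real.cos α)⁻¹ * N (matRe A) := by
  have hcos : 0 < Real.cos α := Real.cos_pos_of_mem_Ioo ⟨by linarith, hα1⟩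
  have hH := aux_re_pd hA
  obtain ⟨P₁, P₂, c, hP1, hP2, hcc, hsum, hdec⟩ := aux_decomp hα0 hα1 hA
  obtain ⟨W, P, hW, hP, hWP⟩ := aux_polar (aux_unit hA)
  set H := matRe A with hHdef
  have mW := aux_mem hW
  have mW' : Wᴴ ∈ Matrix.unitaryGroup (Fin n) ℂ := Unitary.star_mem mW
  have hNA : N A = N P := by
    have h2 := hUI _ 1 P mW (one_mem _)
    rw [Matrix.mul_one] at h2
    rw [hWP, h2]
  set s : ℂ := (((Real.cos α)⁻¹ : ℝ) : ℂ) with hs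
  have hs0 : 0 < s := by rw [hs, Complex.zero_lt_real]; exact inv_pos.2 hcos
  have hs2 : 0 < s * (1 / 2) := by
    have : s * (1 / 2) = (((Real.cos α)⁻¹ * (1 / 2) : ℝ) : ℂ) := by simp [hs]
    rw [this, Complex.zero_lt_real]
    have := inv_pos.2 hcos
    positivity
  have hss : star s = s := Complex.conj_ofReal _
  have hWu : IsUnit W := IsUnit.of_mul_eq_one _ (mul_eq_one_comm.1 hW)
  have hWHW : (Wᴴ * H * W).PosDef :=
    (Matrix.IsUnit.posDef_star_left_conjugate_iff hWu).2 hH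
  have hQ : ((s * (1 / 2)) • (H + Wᴴ * H * W)).PosDef := (hH.add hWHW).smul hs2
  have hPe : P = (s * (1 / 2)) • (c • (Wᴴ * P₁) + star c • (Wᴴ * P₂)
      + (star c • (P₁ * W) + c • (P₂ * W))) := by
    have e1 : P = Wᴴ * A := by rw [hWP, ← Matrix.mul_assoc, hW, Matrix.one_mul]
    have e2 : P = Aᴴ * W := by
      have := congrArg Matrix.conjTranspose e1
      rwa [hP.1.eq, Matrix.conjTranspose_mul, Matrix.conjTranspose_conjTranspose] at this
    have e3 : Aᴴ = s • (star c • P₁ + c • P₂) := by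
      rw [hdec]
      simp only [Matrix.conjTranspose_smul, Matrix.conjTranspose_add, hss, star_star,
        hP1.1.eq, hP2.1.eq]
    have e4 : P = (1 / 2 : ℂ) • (Wᴴ * A + Aᴴ * W) := by
      rw [← e1, ← e2, ← two_smul ℂ P, smul_smul]; norm_num
    rw [e3, hdec] at e4
    rw [e4]
    simp only [Matrix.mul_smul, Matrix.smul_mul, Matrix.mul_add, Matrix.add_mul]
    module
  have hform : ∀ (d : ℂ) (R : Matrix (Fin n) (Fin n) ℂ), star d * d = 1 →
      (1 - d • W)ᴴ * R * (1 - d • W) =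
        R + Wᴴ * R * W - d • (R * W) - star d • (Wᴴ * R) := by
    intro d R hd
    have : (1 - d • W)ᴴ * R * (1 - d • W) =
        R + (star d * d) • (Wᴴ * R * W) - d • (R * W) - star d • (Wᴴ * R) := by
      simp only [Matrix.conjTranspose_sub, Matrix.conjTranspose_smul, Matrix.conjTranspose_one,
        Matrix.mul_sub, Matrix.sub_mul, Matrix.one_mul, Matrix.mul_one, Matrix.smul_mul,
        Matrix.mul_smul]
      module
    rw [this, hd, one_smul]
  have hQP : ((s * (1 / 2)) • (H + Wᴴ * H * W) - P).PosSemidef := by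
    have q1 := hP1.conjTranspose_mul_mul_same (1 - (star c) • W)
    have q2 := hP2.conjTranspose_mul_mul_same (1 - c • W)
    have q := (q1.add q2).smul hs2.le
    convert q using 1
    rw [hform _ _ (by rw [star_star, mul_comm]; exact hcc), hform _ _ hcc, star_star, hPe, ← hsum]
    simp only [Matrix.mul_add, Matrix.add_mul]
    module
  have h1 := aux_mono N hNs hNa hUI hP hQ hQP
  rw [hNs] at h1
  have h2 := hNa H (Wᴴ * H * W)
  rw [hUI _ _ _ mW' mW] at h2
  have hn : ‖s * (1 / 2)‖ = (Real.cos α)⁻¹ * (1 / 2) := by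
    rw [norm_mul, hs, Complex.norm_real, Real.norm_of_nonneg (inv_pos.2 hcos).le]
    norm_num
  rw [hn] at h1
  have h3 := mul_le_mul_of_nonneg_left h2 (by
    have := inv_pos.2 hcos
    positivity : 0 ≤ (Real.cos α)⁻¹ * (1 / 2))
  rw [hNA]
  linarith

theorem aux_re_le {n : ℕ} (N : Matrix (Fin n) (Fin n) ℂ → ℝ)
    (hNs : ∀ (c : ℂ) (A : Matrix (Fin n) (Fin n) ℂ), N (c • A) = ‖c‖ * N A)
    (hNa : ∀ A B : Matrix (Fin n) (Fin n) ℂ, N (A + B) ≤ N A + N B)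
    (A : Matrix (Fin n) (Fin n) ℂ) (θ : ℝ) :
    N (matRe (Complex.exp (θ * Complex.I) • A)) ≤ 1 / 2 * (N A + N Aᴴ) := by
  unfold matRe
  rw [hNs, Matrix.conjTranspose_smul]
  have h := hNa (Complex.exp (θ * Complex.I) • A) (star (Complex.exp (θ * Complex.I)) • Aᴴ)
  rw [hNs, hNs, norm_star, Complex.norm_exp_ofReal_mul_I, one_mul, one_mul] at h
  have hh : ‖(1 / 2 : ℂ)‖ = 1 / 2 := by norm_num
  rw [hh]
  linarith

theorem aux_class {n : ℕ} (N : Matrix (Fin n) (Fin n) ℂ → ℝ)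
    (hNs : ∀ (c : ℂ) (A : Matrix (Fin n) (Fin n) ℂ), N (c • A) = ‖c‖ * N A)
    (hNa : ∀ A B : Matrix (Fin n) (Fin n) ℂ, N (A + B) ≤ N A + N B)
    (hUI : ∀ U V A : Matrix (Fin n) (Fin n) ℂ, U ∈ Matrix.unitaryGroup (Fin n) ℂ →
      V ∈ Matrix.unitaryGroup (Fin n) ℂ → N (U * A * V) = N A)
    {X : Matrix (Fin n) (Fin n) ℂ} {α : ℝ} (hα0 : 0 ≤ α)
    (hα1 : α < Real.pi / 2) (hX : X ∈ sectClass n α) :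
    IsUnit X ∧ N X ≤ (Real.cos α)⁻¹ * gnr N X := by
  obtain ⟨z, hz, hX⟩ := hX
  have hcos : 0 < Real.cos α := Real.cos_pos_of_mem_Ioo ⟨by linarith, hα1⟩
  have hz0 : z ≠ 0 := by rintro rfl; simp at hz
  constructor
  · have h1 := aux_unit hX
    have e : X = z⁻¹ • (1 : Matrix (Fin n) (Fin n) ℂ) * (z • X) := by
      rw [Matrix.smul_mul, Matrix.one_mul, smul_smul, inv_mul_cancel₀ hz0, one_smul]
    rw [e]
    refine IsUnit.mul ?_ h1
    refine IsUnit.of_mul_eq_one (z • 1) ?_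
    rw [Matrix.smul_mul, Matrix.one_mul, smul_smul, inv_mul_cancel₀ hz0, one_smul]
  · have h1 := aux_key N hNs hNa hUI hα0 hα1 hX
    rw [hNs, hz, one_mul] at h1
    refine h1.trans (mul_le_mul_of_nonneg_left ?_ (inv_pos.2 hcos).le)
    have hzz : z = Complex.exp ((z.arg : ℝ) * Complex.I) := by
      have := Complex.norm_mul_exp_arg_mul_I z
      rw [hz] at this
      simpa using this.symm
    rw [hzz]
    refine le_ciSup (f := fun θ : ℝ => N (matRe (Complex.exp (θ * Complex.I) • X))) ?_ z.arg
    refine ⟨1 / 2 * (N X + N Xᴴ), ?_⟩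
    rintro _ ⟨θ, rfl⟩
    exact aux_re_le N hNs hNa X θ

theorem stmt_4 {n : ℕ} (N : Matrix (Fin n) (Fin n) ℂ → ℝ)
    (hN0 : ∀ A : Matrix (Fin n) (Fin n) ℂ, N A = 0 ↔ A = 0)
    (hNs : ∀ (c : ℂ) (A : Matrix (Fin n) (Fin n) ℂ), N (c • A) = ‖c‖ * N A)
    (hNa : ∀ A B : Matrix (Fin n) (Fin n) ℂ, N (A + B) ≤ N A + N B)
    (hUI : ∀ U V A : Matrix (Fin n) (Fin n) ℂ, U ∈ Matrix.unitaryGroup (Fin n) ℂ →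
      V ∈ Matrix.unitaryGroup (Fin n) ℂ → N (U * A * V) = N A)
    (hSM : ∀ A B : Matrix (Fin n) (Fin n) ℂ, N (A * B) ≤ N A * N B)
    {α : ℝ} (hα0 : 0 ≤ α) (hα1 : α < Real.pi / 2)
    (X Y : Matrix (Fin n) (Fin n) ℂ)
    (hX : X ∈ sectClass n α) (hY : Y ∈ sectClass n α) :
    gnr N (X * Y) ≤ ((Real.cos α)⁻¹) ^ 2 * gnr N X * gnr N Y := by
  have hcos : 0 < Real.cos α := Real.cos_pos_of_mem_Ioo ⟨by linarith, hα1⟩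
  obtain ⟨uX, bX⟩ := aux_class N hNs hNa hUI hα0 hα1 hX
  obtain ⟨uY, bY⟩ := aux_class N hNs hNa hUI hα0 hα1 hY
  have hnn : ∀ A, 0 ≤ N A := by
    intro A
    have h := hNa A ((-1 : ℂ) • A)
    rw [hNs] at h
    have h0 : A + (-1 : ℂ) • A = 0 := by simp
    rw [h0, (hN0 0).2 rfl] at h
    simp at h
    linarith
  have h1 : gnr N (X * Y) ≤ N (X * Y) := by
    refine ciSup_le fun θ => ?_
    have := aux_re_le N hNs hNa (X * Y) θ
    rw [aux_adj N hUI (uX.mul uY)] at this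
    linarith
  calc gnr N (X * Y) ≤ N X * N Y := h1.trans (hSM X Y)
    _ ≤ ((Real.cos α)⁻¹ * gnr N X) * ((Real.cos α)⁻¹ * gnr N Y) :=
      mul_le_mul bX bY (hnn Y) ((hnn X).trans bX)
    _ = ((Real.cos α)⁻¹) ^ 2 * gnr N X * gnr N Y := by ring
end

section
/- Let N be a submultiplicative, unitarily invariant norm on the n×n complex matrices. If X, Y ∈ M_n are both accretive-dissipative, then ω_N(XY) ≤ 2·ω_N(X)·ω_N(Y). -/
open scoped ComplexOrder Matrix

section helpers
open scoped MatrixOrder Matrix.Norms.L2Operator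

lemma exists_psd_sqrt {n : ℕ} (A : Matrix (Fin n) (Fin n) ℂ) (hA : A.PosSemidef) :
    ∃ S : Matrix (Fin n) (Fin n) ℂ, S.PosSemidef ∧ S * S = A :=
  ⟨CFC.sqrt A, Matrix.nonneg_iff_posSemidef.1 (CFC.sqrt_nonneg A), CFC.sqrt_mul_sqrt_self A hA.nonneg⟩

lemma exists_polar {n : ℕ} (Z : Matrix (Fin n) (Fin n) ℂ) (hZ : IsUnit Z) :
    ∃ W H : Matrix (Fin n) (Fin n) ℂ, W ∈ Matrix.unitaryGroup (Fin n) ℂ ∧ H.PosSemidef ∧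
      Z = W * H := by
  obtain ⟨H, hH, hHH⟩ := exists_psd_sqrt _ (Matrix.posSemidef_conjTranspose_mul_self Z)
  have hu : IsUnit H := by
    have h1 : IsUnit (H * H) := by
      rw [hHH]; exact hZ.star.mul hZ
    rw [Matrix.isUnit_iff_isUnit_det, Matrix.det_mul] at h1
    rw [Matrix.isUnit_iff_isUnit_det]
    exact isUnit_of_mul_isUnit_left h1
  have hd := (Matrix.isUnit_iff_isUnit_det _).1 hu
  refine ⟨Z * H⁻¹, H, ?_, hH, ?_⟩
  · rw [Matrix.mem_unitaryGroup_iff', Matrix.star_eq_conjTranspose, Matrix.conjTranspose_mul,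
      Matrix.conjTranspose_nonsing_inv, hH.isHermitian.eq]
    calc H⁻¹ * Zᴴ * (Z * H⁻¹) = H⁻¹ * (Zᴴ * Z) * H⁻¹ := by simp only [mul_assoc]
      _ = (H⁻¹ * H) * (H * H⁻¹) := by rw [← hHH]; simp only [mul_assoc]
      _ = 1 := by rw [Matrix.nonsing_inv_mul _ hd, Matrix.mul_nonsing_inv _ hd, mul_one]
  · rw [mul_assoc, Matrix.nonsing_inv_mul _ hd, mul_one]

structure UINorm {n : ℕ} (N : Matrix (Fin n) (Fin n) ℂ → ℝ) : Prop where
  s : ∀ (c : ℂ) (A : Matrix (Fin n) (Fin n) ℂ), N (c • A) = ‖c‖ * N A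
  a : ∀ A B : Matrix (Fin n) (Fin n) ℂ, N (A + B) ≤ N A + N B
  u : ∀ U V A : Matrix (Fin n) (Fin n) ℂ, U ∈ Matrix.unitaryGroup (Fin n) ℂ →
      V ∈ Matrix.unitaryGroup (Fin n) ℂ → N (U * A * V) = N A

namespace UINorm
variable {n : ℕ} {N : Matrix (Fin n) (Fin n) ℂ → ℝ}

lemma ul (h : UINorm N) {U : Matrix (Fin n) (Fin n) ℂ} (A : Matrix (Fin n) (Fin n) ℂ)
    (hU : U ∈ Matrix.unitaryGroup (Fin n) ℂ) : N (U * A) = N A := by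
  simpa using h.u U 1 A hU (one_mem _)

lemma ur (h : UINorm N) {U : Matrix (Fin n) (Fin n) ℂ} (A : Matrix (Fin n) (Fin n) ℂ)
    (hU : U ∈ Matrix.unitaryGroup (Fin n) ℂ) : N (A * U) = N A := by
  simpa using h.u 1 U A (one_mem _) hU

lemma nonneg (h : UINorm N) (A : Matrix (Fin n) (Fin n) ℂ) : 0 ≤ N A := by
  have h0 : N 0 = 0 := by simpa using h.s 0 0
  have h1 := h.a A ((-1 : ℂ) • A)
  rw [h.s] at h1
  simp [h0] at h1
  linarith

lemma half (h : UINorm N) (A B : Matrix (Fin n) (Fin n) ℂ) :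
    N ((1 / 2 : ℂ) • (A + B)) ≤ (N A + N B) / 2 := by
  rw [h.s]
  have := h.a A B
  norm_num
  linarith

lemma star_eq (h : UINorm N) (Z : Matrix (Fin n) (Fin n) ℂ) (hZ : IsUnit Z) : N Zᴴ = N Z := by
  obtain ⟨W, H, hW, hH, rfl⟩ := exists_polar Z hZ
  rw [Matrix.conjTranspose_mul, hH.isHermitian.eq, h.ul _ hW]
  exact h.ur _ (Unitary.star_mem hW)

lemma swap (h : UINorm N) (Z : Matrix (Fin n) (Fin n) ℂ) (hZ : IsUnit Z) :
    N (Zᴴ * Z) = N (Z * Zᴴ) := by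
  obtain ⟨W, H, hW, hH, rfl⟩ := exists_polar Z hZ
  have hW1 := Matrix.mem_unitaryGroup_iff'.1 hW
  rw [Matrix.star_eq_conjTranspose] at hW1
  rw [Matrix.conjTranspose_mul, hH.isHermitian.eq]
  have e1 : H * Wᴴ * (W * H) = H * H := by
    rw [mul_assoc, ← mul_assoc Wᴴ, hW1, one_mul]
  have e2 : W * H * (H * Wᴴ) = W * (H * H) * Wᴴ := by simp only [mul_assoc]
  rw [e1, e2]
  exact (h.u _ _ _ hW (Unitary.star_mem hW)).symm

lemma exists_avg (K : Matrix (Fin n) (Fin n) ℂ) (hK : K.IsHermitian) (h1 : ‖K‖ ≤ 1) :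
    ∃ U ∈ Matrix.unitaryGroup (Fin n) ℂ, K = (1 / 2 : ℂ) • (U + Uᴴ) := by
  refine ⟨_, IsSelfAdjoint.self_add_I_smul_cfcSqrt_sub_sq_mem_unitary K hK h1, ?_⟩
  have hs : (CFC.sqrt (1 - K ^ 2))ᴴ = CFC.sqrt (1 - K ^ 2) :=
    (Matrix.nonneg_iff_posSemidef.1 (CFC.sqrt_nonneg (1 - K ^ 2))).isHermitian.eq
  rw [Matrix.conjTranspose_add, Matrix.conjTranspose_smul, hs, hK.eq]
  simp only [Complex.star_def, Complex.conj_I]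
  module

lemma contr (h : UINorm N) (K A : Matrix (Fin n) (Fin n) ℂ) (hK : K.IsHermitian) (h1 : ‖K‖ ≤ 1) :
    N (K * A * K) ≤ N A := by
  obtain ⟨U, hU, e⟩ := exists_avg K hK h1
  have hU' : Uᴴ ∈ Matrix.unitaryGroup (Fin n) ℂ := Unitary.star_mem hU
  have l : ∀ B, N (K * B) ≤ N B := fun B => by
    have := h.half (U * B) (Uᴴ * B)
    rw [h.ul _ hU, h.ul _ hU'] at this
    rw [e, smul_mul_assoc, add_mul]
    linarith
  have r : ∀ B, N (B * K) ≤ N B := fun B => by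
    have := h.half (B * U) (B * Uᴴ)
    rw [h.ur _ hU, h.ur _ hU'] at this
    rw [e, mul_smul_comm, mul_add]
    linarith
  exact (r _).trans (l _)

lemma mono (h : UINorm N) (R Q : Matrix (Fin n) (Fin n) ℂ) (hR : R.PosDef) (hQ : Q.PosDef)
    (hRQ : (Q - R).PosSemidef) : N R ≤ N Q := by
  obtain ⟨T, hT, hTT⟩ := exists_psd_sqrt Q hQ.posSemidef
  have hTe := hT.isHermitian.eq
  have hd : IsUnit T.det := by
    have h1 := (Matrix.isUnit_iff_isUnit_det _).1 hQ.isUnit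
    rw [← hTT, Matrix.det_mul] at h1
    exact isUnit_of_mul_isUnit_left h1
  have hTi : (T⁻¹)ᴴ = T⁻¹ := by rw [Matrix.conjTranspose_nonsing_inv, hTe]
  have a1 : T⁻¹ * T = 1 := Matrix.nonsing_inv_mul _ hd
  have a2 : T * T⁻¹ = 1 := Matrix.mul_nonsing_inv _ hd
  have hM : (T⁻¹ * R * T⁻¹).PosSemidef := by
    have := hR.posSemidef.conjTranspose_mul_mul_same T⁻¹
    rwa [hTi] at this
  obtain ⟨K, hK, hKK⟩ := exists_psd_sqrt _ hM
  have hKR : R = T * (K * K) * T := by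
    rw [hKK]
    calc R = (T * T⁻¹) * R * (T⁻¹ * T) := by rw [a1, a2, one_mul, mul_one]
      _ = _ := by simp only [mul_assoc]
  have hK1 : ‖K‖ ≤ 1 := by
    have h2 : T⁻¹ * R * T⁻¹ ≤ 1 := by
      rw [Matrix.le_iff]
      have := hRQ.conjTranspose_mul_mul_same T⁻¹
      rw [hTi, mul_sub, sub_mul, ← hTT] at this
      have e3 : T⁻¹ * (T * T) * T⁻¹ = 1 := by
        calc T⁻¹ * (T * T) * T⁻¹ = (T⁻¹ * T) * (T * T⁻¹) := by simp only [mul_assoc]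
          _ = 1 := by rw [a1, a2, one_mul]
      rwa [e3] at this
    have h3 := (CStarAlgebra.norm_le_one_iff_of_nonneg _ hM.nonneg).2 h2
    have h4 : ‖K * K‖ = ‖K‖ * ‖K‖ := by
      have := Matrix.l2_opNorm_conjTranspose_mul_self K
      rwa [hK.isHermitian.eq] at this
    rw [← hKK, h4] at h3
    nlinarith [norm_nonneg K]
  have hKT : IsUnit (K * T) := by
    have h1 := (Matrix.isUnit_iff_isUnit_det _).1 hR.isUnit
    rw [hKR, Matrix.det_mul, Matrix.det_mul, Matrix.det_mul] at h1
    rw [Matrix.isUnit_iff_isUnit_det, Matrix.det_mul]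
    rw [isUnit_iff_ne_zero] at *
    intro h0
    apply h1
    linear_combination (T.det * K.det) * h0
  have e := h.swap (K * T) hKT
  rw [Matrix.conjTranspose_mul, hTe, hK.isHermitian.eq] at e
  calc N R = N (T * K * (K * T)) := by rw [hKR]; simp only [mul_assoc]
    _ = N (K * Q * K) := by rw [e, ← hTT]; simp only [mul_assoc]
    _ ≤ N Q := h.contr _ _ hK.isHermitian hK1

end UINorm

section main
variable {n : ℕ} {N : Matrix (Fin n) (Fin n) ℂ → ℝ}

lemma mat_decomp (X : Matrix (Fin n) (Fin n) ℂ) : X = matRe X + Complex.I • matIm X := by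
  unfold matRe matIm
  rw [smul_smul]
  have : Complex.I * (1 / (2 * Complex.I)) = 1 / 2 := by
    field_simp
  rw [this]
  module

lemma accr_isUnit (X : Matrix (Fin n) (Fin n) ℂ) (hX : (matRe X).PosDef) : IsUnit X := by
  rw [← Matrix.mulVec_injective_iff_isUnit]
  refine (injective_iff_map_eq_zero (Matrix.mulVecLin X)).2 fun v hv => ?_
  by_contra h0
  have h1 := hX.dotProduct_mulVec_pos h0
  have hv' : X *ᵥ v = 0 := hv
  have h2 : star v ⬝ᵥ (Xᴴ *ᵥ v) = 0 := by
    rw [Matrix.dotProduct_mulVec, Matrix.vecMul_conjTranspose, star_star, hv']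
    simp
  rw [matRe, Matrix.smul_mulVec, Matrix.add_mulVec, dotProduct_smul, dotProduct_add, h2, hv'] at h1
  simp at h1

lemma norm_le_sum (h : UINorm N) (X : Matrix (Fin n) (Fin n) ℂ)
    (hA : (matRe X).PosDef) (hB : (matIm X).PosDef) : N X ≤ N (matRe X + matIm X) := by
  obtain ⟨W, H, hW, hH, e⟩ := exists_polar X (accr_isUnit X hA)
  have hW1 := Matrix.mem_unitaryGroup_iff'.1 hW
  rw [Matrix.star_eq_conjTranspose] at hW1
  have hHu : IsUnit H := by
    have := accr_isUnit X hA
    rw [e, Matrix.isUnit_iff_isUnit_det, Matrix.det_mul] at this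
    rw [Matrix.isUnit_iff_isUnit_det]
    exact isUnit_of_mul_isUnit_right this
  have hNX : N X = N H := by rw [e, h.ul _ hW]
  have hdec := mat_decomp X
  rw [hNX]
  generalize matRe X = A at *
  generalize matIm X = B at *
  have hHp : H.PosDef := hH.posDef_iff_isUnit.2 hHu
  have e1 : Wᴴ * X = H := by rw [e, ← mul_assoc, hW1, one_mul]
  have e2 : Xᴴ * W = H := by
    have := congrArg Matrix.conjTranspose e1
    rwa [Matrix.conjTranspose_mul, Matrix.conjTranspose_conjTranspose, hH.isHermitian.eq] at this
  have hS : (A + B).PosDef := hA.add hB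
  have hS' : (Wᴴ * (A + B) * W).PosSemidef := hS.posSemidef.conjTranspose_mul_mul_same W
  have hQ : ((1 / 2 : ℂ) • ((A + B) + Wᴴ * (A + B) * W)).PosDef :=
    (hS.add_posSemidef hS').smul (by norm_num)
  have hle : ((1 / 2 : ℂ) • ((A + B) + Wᴴ * (A + B) * W) - H).PosSemidef := by
    have p1 := hA.posSemidef.conjTranspose_mul_mul_same (1 - W)
    have p2 := hB.posSemidef.conjTranspose_mul_mul_same (W - Complex.I • 1)
    have p3 := (p1.add p2).smul (show (0 : ℂ) ≤ 1 / 2 by rw [Complex.le_def]; norm_num)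
    convert p3 using 1
    have eH : H = (1 / 2 : ℂ) • (Wᴴ * X + Xᴴ * W) := by rw [e1, e2]; module
    rw [eH, hdec]
    simp only [Matrix.conjTranspose_add, Matrix.conjTranspose_sub, Matrix.conjTranspose_smul,
      Matrix.conjTranspose_one, hA.isHermitian.eq, hB.isHermitian.eq, mul_add, add_mul, mul_sub,
      sub_mul, smul_mul_assoc, mul_smul_comm, mul_one, one_mul, Complex.star_def, Complex.conj_I]
    match_scalars <;> first | ring1 | linear_combination (1 / 2 : ℂ) * Complex.I_sq
  refine (h.mono _ _ hHp hQ hle).trans ((h.half _ _).trans ?_)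
  rw [h.u Wᴴ _ _ (Unitary.star_mem hW) hW]
  linarith

lemma re_le (h : UINorm N) (Z : Matrix (Fin n) (Fin n) ℂ) (hZ : IsUnit Z) (θ : ℝ) :
    N (matRe (Complex.exp (θ * Complex.I) • Z)) ≤ N Z := by
  have h1 := h.half (Complex.exp (θ * Complex.I) • Z) (Complex.exp (θ * Complex.I) • Z)ᴴ
  rw [Matrix.conjTranspose_smul, h.s _ Z, h.s _ Zᴴ, h.star_eq Z hZ, norm_star,
    Complex.norm_exp_ofReal_mul_I] at h1
  rw [matRe, Matrix.conjTranspose_smul]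
  linarith

lemma norm_le_gnr (h : UINorm N) (X : Matrix (Fin n) (Fin n) ℂ)
    (hA : (matRe X).PosDef) (hB : (matIm X).PosDef) : N X ≤ √2 * gnr N X := by
  have hb : BddAbove (Set.range fun θ : ℝ => N (matRe (Complex.exp (θ * Complex.I) • X))) :=
    ⟨N X, by rintro _ ⟨θ, rfl⟩; exact re_le h X (accr_isUnit X hA) θ⟩
  have h1 : N (matRe (Complex.exp (((-(Real.pi / 4) : ℝ) : ℂ) * Complex.I) • X)) ≤ gnr N X :=
    le_ciSup hb (-(Real.pi / 4))
  have hexp : Complex.exp (((-(Real.pi / 4) : ℝ) : ℂ) * Complex.I)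
      = ((√2 / 2 : ℝ) : ℂ) * (1 - Complex.I) := by
    rw [Complex.exp_mul_I, ← Complex.ofReal_cos, ← Complex.ofReal_sin, Real.cos_neg, Real.sin_neg,
      Real.cos_pi_div_four, Real.sin_pi_div_four]
    push_cast
    ring
  have h2 : matRe (Complex.exp (((-(Real.pi / 4) : ℝ) : ℂ) * Complex.I) • X)
      = ((√2 / 2 : ℝ) : ℂ) • (matRe X + matIm X) := by
    rw [hexp]
    have hI : (1 / (2 * Complex.I)) = -(1 / 2) * Complex.I := by
      field_simp
      simp
    unfold matRe matIm
    rw [hI, Matrix.conjTranspose_smul]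
    simp only [Complex.star_def, map_mul, map_sub, Complex.conj_ofReal, Complex.conj_I, map_one]
    module
  rw [h2, h.s, Complex.norm_real, Real.norm_of_nonneg (by positivity)] at h1
  have h3 := norm_le_sum h X hA hB
  have h4 : √2 * √2 = 2 := Real.mul_self_sqrt (by norm_num)
  calc N X ≤ N (matRe X + matIm X) := h3
    _ = √2 * (√2 / 2 * N (matRe X + matIm X)) := by
      linear_combination (-(N (matRe X + matIm X)) / 2) * h4
    _ ≤ _ := by gcongr

end main

end helpers

theorem stmt_5 {n : ℕ} (N : Matrix (Fin n) (Fin n) ℂ → ℝ)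
    (hN0 : ∀ A : Matrix (Fin n) (Fin n) ℂ, N A = 0 ↔ A = 0)
    (hNs : ∀ (c : ℂ) (A : Matrix (Fin n) (Fin n) ℂ), N (c • A) = ‖c‖ * N A)
    (hNa : ∀ A B : Matrix (Fin n) (Fin n) ℂ, N (A + B) ≤ N A + N B)
    (hUI : ∀ U V A : Matrix (Fin n) (Fin n) ℂ, U ∈ Matrix.unitaryGroup (Fin n) ℂ →
      V ∈ Matrix.unitaryGroup (Fin n) ℂ → N (U * A * V) = N A)
    (hSM : ∀ A B : Matrix (Fin n) (Fin n) ℂ, N (A * B) ≤ N A * N B)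
    (X Y : Matrix (Fin n) (Fin n) ℂ)
    (hX : (matRe X).PosDef ∧ (matIm X).PosDef)
    (hY : (matRe Y).PosDef ∧ (matIm Y).PosDef) :
    gnr N (X * Y) ≤ 2 * gnr N X * gnr N Y := by
  have h : UINorm N := ⟨hNs, hNa, hUI⟩
  have h1 := norm_le_gnr h X hX.1 hX.2
  have h2 := norm_le_gnr h Y hY.1 hY.2
  have hu : IsUnit (X * Y) := (accr_isUnit X hX.1).mul (accr_isUnit Y hY.1)
  have h4 : √2 * √2 = 2 := Real.mul_self_sqrt (by norm_num)
  calc gnr N (X * Y) ≤ N (X * Y) := ciSup_le fun θ => re_le h _ hu θ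
    _ ≤ N X * N Y := hSM X Y
    _ ≤ (√2 * gnr N X) * (√2 * gnr N Y) :=
      mul_le_mul h1 h2 (h.nonneg _) ((h.nonneg _).trans h1)
    _ = 2 * gnr N X * gnr N Y := by
      linear_combination (gnr N X * gnr N Y) * h4
end

section
/- Let N be a submultiplicative, unitarily invariant norm on the n×n complex matrices, let m ≥ 1, and let α ∈ [0, π/2). If X₁, …, X_m ∈ M^s_{n,α}, then ω_N(X₁X₂⋯X_m) ≤ sec^m(α)·ω_N(X₁)·ω_N(X₂)⋯ω_N(X_m). -/
open scoped ComplexOrder Matrix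

section helpers

variable {n : ℕ}

local notation "Mn" => Matrix (Fin n) (Fin n) ℂ

/-- sesquilinear form -/
noncomputable def sform (A : Matrix (Fin n) (Fin n) ℂ) (x y : Fin n → ℂ) : ℂ :=
  star x ⬝ᵥ A.mulVec y

lemma sform_add_left (A : Mn) (x y z : Fin n → ℂ) :
    sform A (x + y) z = sform A x z + sform A y z := by
  simp [sform, add_dotProduct]

lemma sform_add_right (A : Mn) (x y z : Fin n → ℂ) :
    sform A x (y + z) = sform A x y + sform A x z := by
  simp [sform, Matrix.mulVec_add, dotProduct_add]

lemma sform_smul_left (A : Mn) (c : ℂ) (x y : Fin n → ℂ) :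
    sform A (c • x) y = star c * sform A x y := by
  simp [sform, smul_dotProduct]

lemma sform_smul_right (A : Mn) (c : ℂ) (x y : Fin n → ℂ) :
    sform A x (c • y) = c * sform A x y := by
  simp [sform, Matrix.mulVec_smul, dotProduct_smul]

lemma sform_star (A : Mn) (x y : Fin n → ℂ) :
    star (sform A x y) = sform Aᴴ y x := by
  unfold sform
  rw [← Matrix.star_dotProduct_star, star_star, Matrix.star_mulVec, Matrix.dotProduct_mulVec,
    dotProduct_comm, dotProduct_comm]

lemma matRe_herm (X : Mn) : (matRe X)ᴴ = matRe X := by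
  unfold matRe
  rw [Matrix.conjTranspose_smul, Matrix.conjTranspose_add, Matrix.conjTranspose_conjTranspose,
    add_comm]
  simp

lemma matIm_herm (X : Mn) : (matIm X)ᴴ = matIm X := by
  unfold matIm
  rw [Matrix.conjTranspose_smul, Matrix.conjTranspose_sub, Matrix.conjTranspose_conjTranspose,
    ← neg_sub X, smul_neg, ← neg_smul]
  congr 1
  simp

lemma re_im_decomp (X : Mn) : X = matRe X + Complex.I • matIm X := by
  unfold matRe matIm
  rw [smul_smul]
  have : Complex.I * (1 / (2 * Complex.I)) = 1 / 2 := by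
    field_simp
  rw [this, ← smul_add]
  ext i j
  simp
  ring

lemma sform_decomp (X : Mn) (x y : Fin n → ℂ) :
    sform X x y = sform (matRe X) x y + Complex.I * sform (matIm X) x y := by
  conv_lhs => rw [re_im_decomp X]
  simp [sform, Matrix.add_mulVec, dotProduct_add, Matrix.smul_mulVec, dotProduct_smul]

lemma sform_herm_im {A : Mn} (h : Aᴴ = A) (x : Fin n → ℂ) : (sform A x x).im = 0 := by
  have := sform_star A x x
  rw [h] at this
  exact Complex.conj_eq_iff_im.mp this

lemma sform_herm_re {A : Mn} (h : Aᴴ = A) (x y : Fin n → ℂ) :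
    (sform A x y).re = (sform A y x).re := by
  have := sform_star A x y
  rw [h] at this
  rw [← this]; simp

lemma sform_herm_im' {A : Mn} (h : Aᴴ = A) (x y : Fin n → ℂ) :
    (sform A x y).im = - (sform A y x).im := by
  have := sform_star A x y
  rw [h] at this
  rw [← this]; simp

lemma sector_all {X : Mn} {α : ℝ} (hX : numRange X ⊆ sector α) {x : Fin n → ℂ} (hx : x ≠ 0) :
    0 < (sform X x x).re ∧ |(sform X x x).im| ≤ Real.tan α * (sform X x x).re := by
  have hpos : 0 < star x ⬝ᵥ x := Matrix.dotProduct_star_self_pos_iff.mpr hx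
  rw [Complex.lt_def] at hpos
  obtain ⟨h1, h2⟩ := hpos
  set r : ℝ := (star x ⬝ᵥ x).re with hr
  have hxr : star x ⬝ᵥ x = (r : ℂ) := by
    apply Complex.ext <;> simp [hr]
    simpa using h2.symm
  have h1' : 0 < r := by simpa using h1
  set c : ℝ := (Real.sqrt r)⁻¹ with hc
  have hc2 : c * c * r = 1 := by
    rw [hc, ← mul_inv, Real.mul_self_sqrt h1'.le, inv_mul_cancel₀ h1'.ne']
  have hcc : 0 < c * c := by
    by_contra hh
    nlinarith [mul_self_nonneg c]
  have key := hX (show sform X ((c : ℂ) • x) ((c : ℂ) • x) ∈ numRange X from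
    ⟨(c : ℂ) • x, by
      rw [star_smul, smul_dotProduct, dotProduct_smul, hxr]
      simp only [smul_eq_mul, Complex.star_def, Complex.conj_ofReal]
      rw [← mul_assoc]
      exact_mod_cast hc2, rfl⟩)
  rw [sform_smul_left, sform_smul_right] at key
  have e : star (c : ℂ) * ((c : ℂ) * sform X x x) = ((c * c : ℝ) : ℂ) * sform X x x := by
    simp [mul_assoc]
  rw [e] at key
  obtain ⟨k1, k2⟩ := key
  rw [Complex.re_ofReal_mul] at k1 k2
  rw [Complex.im_ofReal_mul, abs_mul, abs_of_pos hcc] at k2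
  refine ⟨(mul_pos_iff_of_pos_left hcc).mp k1, ?_⟩
  apply le_of_mul_le_mul_left _ hcc
  linarith

lemma sector_re_im {X : Mn} {α : ℝ} (hX : numRange X ⊆ sector α) (x : Fin n → ℂ) :
    0 ≤ (sform (matRe X) x x).re ∧
    |(sform (matIm X) x x).re| ≤ Real.tan α * (sform (matRe X) x x).re := by
  by_cases hx : x = 0
  · subst hx; simp [sform]
  have h := sector_all hX hx
  rw [sform_decomp] at h
  have e1 := sform_herm_im (matRe_herm X) x
  have e2 := sform_herm_im (matIm_herm X) x
  simp only [Complex.add_re, Complex.mul_re, Complex.I_re, Complex.I_im, Complex.add_im,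
    Complex.mul_im, e1, e2, zero_mul, one_mul, mul_zero, sub_zero, add_zero, zero_add] at h
  exact ⟨h.1.le, h.2⟩

lemma unit_of_sector {X : Mn} {α : ℝ} (hX : numRange X ⊆ sector α) : X.det ≠ 0 := by
  intro h
  obtain ⟨v, hv, hv0⟩ := Matrix.exists_mulVec_eq_zero_iff.mpr h
  have := (sector_all hX hv).1
  simp [sform, hv0] at this

lemma unit_re_of_sector {X : Mn} {α : ℝ} (hX : numRange X ⊆ sector α) : (matRe X).det ≠ 0 := by
  intro h
  obtain ⟨v, hv, hv0⟩ := Matrix.exists_mulVec_eq_zero_iff.mpr h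
  have := (sector_all hX hv).1
  rw [sform_decomp] at this
  have e2 := sform_herm_im (matIm_herm X) v
  have e3 : sform (matRe X) v v = 0 := by simp [sform, hv0]
  simp [e2, e3] at this

/-- main sesquilinear estimate -/
lemma sector_form_bound {X : Mn} {α : ℝ} (hα0 : 0 ≤ α) (hα1 : α < Real.pi / 2)
    (hX : numRange X ⊆ sector α) (p q : Fin n → ℂ) :
    (sform X p q).re ≤ (Real.cos α)⁻¹ *
      ((1 / 2) * ((sform (matRe X) p p).re + (sform (matRe X) q q).re)) := by
  have hA := matRe_herm X
  have hB := matIm_herm X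
  have hS := sector_re_im hX
  have hdet := unit_re_of_sector hX
  have hdec := sform_decomp X p q
  set A := matRe X with hAdef
  set B := matIm X with hBdef
  set t := Real.tan α with ht
  have ht0 : 0 ≤ t := Real.tan_nonneg_of_nonneg_of_le_pi_div_two hα0 hα1.le
  have hcos : 0 < Real.cos α := Real.cos_pos_of_mem_Ioo ⟨by linarith [Real.pi_pos], hα1⟩
  set c := Real.cos α with hc
  have htc : (1 + t ^ 2) * c ^ 2 = 1 := by
    have h1 : t * c = Real.sin α := Real.tan_mul_cos hcos.ne'
    have h2 := Real.sin_sq_add_cos_sq α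
    rw [← h1, ← hc] at h2
    linarith
  set r : Fin n → ℂ := A⁻¹.mulVec (B.mulVec q) with hr
  have hAr : A.mulVec r = B.mulVec q := by
    rw [hr, Matrix.mulVec_mulVec, Matrix.mul_nonsing_inv _ (isUnit_iff_ne_zero.mpr hdet),
      Matrix.one_mulVec]
  have hform : ∀ y, sform A y r = sform B y q := fun y => by simp [sform, hAr]
  -- bound on a(r)
  have har : (sform A r r).re ≤ t ^ 2 * (sform A q q).re := by
    have hpol : ∀ μ : ℝ, 2 * μ * (sform A r r).re ≤
        t * (μ ^ 2 * (sform A q q).re + (sform A r r).re) := by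
      intro μ
      have h1 := (abs_le.mp (hS ((μ : ℂ) • q + r)).2).2
      have h2 := (abs_le.mp (hS ((μ : ℂ) • q + (-1 : ℂ) • r)).2).1
      have e1 := sform_herm_re hB q r
      have e2 := sform_herm_re hA q r
      have e3 := hform r
      simp only [sform_add_left, sform_add_right, sform_smul_left, sform_smul_right,
        Complex.star_def, Complex.conj_ofReal, Complex.add_re, Complex.re_ofReal_mul,
        map_neg, map_one, neg_mul, one_mul, mul_neg, Complex.neg_re, neg_neg] at h1 h2
      rw [e3]
      rw [e1] at h1 h2
      rw [e2, e3] at h1 h2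
      linarith
    rcases ht0.eq_or_lt with h0 | h0
    · have := hpol 1
      rw [← h0] at this ⊢
      linarith
    · have := hpol t
      have h3 : t * (sform A r r).re ≤ t * (t ^ 2 * (sform A q q).re) := by linarith
      exact le_of_mul_le_mul_left h3 h0
  set w : Fin n → ℂ := q + Complex.I • r with hw
  have hXw : sform X p q = sform A p w := by
    rw [hdec, hw, sform_add_right, sform_smul_right, hform]
  have haw : (sform A w w).re ≤ (1 + t ^ 2) * (sform A q q).re := by
    have e1 := sform_herm_im' hA q r
    have e2 : (sform A q r).im = 0 := by rw [hform]; exact sform_herm_im hB q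
    rw [hw]
    simp only [sform_add_left, sform_add_right, sform_smul_left, sform_smul_right,
      Complex.star_def, Complex.conj_I, Complex.add_re, Complex.mul_re, Complex.mul_im,
      Complex.I_re, Complex.I_im, Complex.neg_re, Complex.neg_im]
    simp
    linarith
  -- AM-GM
  have ham : 2 * c * (sform A p w).re ≤ (sform A p p).re + c ^ 2 * (sform A w w).re := by
    have h1 := (hS (p + ((-c : ℝ) : ℂ) • w)).1
    have e1 := sform_herm_re hA p w
    simp only [sform_add_left, sform_add_right, sform_smul_left, sform_smul_right,
        Complex.star_def, Complex.conj_ofReal, Complex.add_re, Complex.re_ofReal_mul] at h1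
    rw [← e1] at h1
    linarith
  rw [hXw, inv_mul_eq_div, le_div_iff₀ hcos]
  have h4 : c ^ 2 * (sform A w w).re ≤ (sform A q q).re := by
    calc c ^ 2 * (sform A w w).re ≤ c ^ 2 * ((1 + t ^ 2) * (sform A q q).re) := by gcongr
      _ = ((1 + t ^ 2) * c ^ 2) * (sform A q q).re := by ring
      _ = _ := by rw [htc, one_mul]
  linarith

/-- SVD for invertible matrices -/
lemma svd_inv (X : Mn) (hX : X.det ≠ 0) :
    ∃ P ∈ Matrix.unitaryGroup (Fin n) ℂ, ∃ Q ∈ Matrix.unitaryGroup (Fin n) ℂ,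
      ∃ s : Fin n → ℝ, (∀ i, 0 ≤ s i) ∧ P * X * Q = Matrix.diagonal (fun i => (s i : ℂ)) := by
  have hXu : IsUnit X := (Matrix.isUnit_iff_isUnit_det X).mpr (isUnit_iff_ne_zero.mpr hX)
  have hpd : (Xᴴ * X).PosDef :=
    Matrix.PosDef.conjTranspose_mul_self X (Matrix.mulVec_injective_iff_isUnit.mpr hXu)
  have hH := hpd.isHermitian
  set V : Mn := (hH.eigenvectorUnitary : Mn) with hV
  have hVu : V ∈ Matrix.unitaryGroup (Fin n) ℂ := hH.eigenvectorUnitary.2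
  have hVV : Vᴴ * V = 1 := Matrix.mem_unitaryGroup_iff'.mp hVu
  set h := hH.eigenvalues with hh
  have hpos : ∀ i, 0 < h i := hpd.eigenvalues_pos
  have hspec : Xᴴ * X = V * Matrix.diagonal (fun i => (h i : ℂ)) * Vᴴ := by
    have := hH.spectral_theorem
    rw [Unitary.conjStarAlgAut_apply] at this
    exact this
  have hdiag : Vᴴ * (Xᴴ * X) * V = Matrix.diagonal (fun i => (h i : ℂ)) := by
    rw [hspec]
    calc Vᴴ * (V * Matrix.diagonal (fun i => (h i : ℂ)) * Vᴴ) * V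
        = (Vᴴ * V) * Matrix.diagonal (fun i => (h i : ℂ)) * (Vᴴ * V) := by
          simp only [Matrix.mul_assoc]
      _ = _ := by rw [hVV]; simp
  have hsq : ∀ i, (Real.sqrt (h i)) * Real.sqrt (h i) = h i := fun i =>
    Real.mul_self_sqrt (hpos i).le
  have hsne : ∀ i, Real.sqrt (h i) ≠ 0 := fun i => (Real.sqrt_pos.mpr (hpos i)).ne'
  set D : Mn := Matrix.diagonal (fun i => (((Real.sqrt (h i))⁻¹ : ℝ) : ℂ)) with hD
  have hDD : Dᴴ = D := by
    rw [hD, Matrix.diagonal_conjTranspose]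
    congr 1
    ext i
    simp
  refine ⟨D * Vᴴ * Xᴴ, ?_, V, hVu, fun i => Real.sqrt (h i), fun i => Real.sqrt_nonneg _, ?_⟩
  · rw [Matrix.mem_unitaryGroup_iff, Matrix.star_eq_conjTranspose]
    calc D * Vᴴ * Xᴴ * (D * Vᴴ * Xᴴ)ᴴ = D * (Vᴴ * (Xᴴ * X) * V) * D := by
          simp only [Matrix.conjTranspose_mul, Matrix.conjTranspose_conjTranspose, hDD,
            Matrix.mul_assoc]
      _ = 1 := by
          rw [hdiag, hD, Matrix.diagonal_mul_diagonal, Matrix.diagonal_mul_diagonal,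
            ← Matrix.diagonal_one]
          congr 1
          ext i
          rw [← Complex.ofReal_mul, ← Complex.ofReal_mul, ← Complex.ofReal_one]
          congr 1
          have := hsne i
          rw [← hsq i]
          field_simp
          simp [hsq i]
  · calc D * Vᴴ * Xᴴ * X * V = D * (Vᴴ * (Xᴴ * X) * V) := by
          simp only [Matrix.mul_assoc]
      _ = _ := by
          rw [hdiag, hD, Matrix.diagonal_mul_diagonal]
          congr 1
          ext i
          rw [← Complex.ofReal_mul]
          congr 1
          have := hsne i
          nth_rewrite 2 [← hsq i]
          field_simp

lemma diag_unitary (u : Fin n → ℂ) (hu : ∀ i, u i * star (u i) = 1) :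
    Matrix.diagonal u ∈ Matrix.unitaryGroup (Fin n) ℂ := by
  rw [Matrix.mem_unitaryGroup_iff, Matrix.star_eq_conjTranspose, Matrix.diagonal_conjTranspose,
    Matrix.diagonal_mul_diagonal, ← Matrix.diagonal_one]
  congr 1
  ext i
  simpa using hu i

lemma pinch_avg (M : Mn) :
    ∑ ε : Fin n → ℤˣ, Matrix.diagonal (fun i => (((ε i : ℤˣ) : ℤ) : ℂ)) * M *
      Matrix.diagonal (fun i => (((ε i : ℤˣ) : ℤ) : ℂ)) =
      (Fintype.card (Fin n → ℤˣ) : ℂ) • Matrix.diagonal (fun i => M i i) := by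
  have hsq : ∀ u : ℤˣ, ((u : ℤ) : ℂ) * ((u : ℤ) : ℂ) = 1 := by
    intro u
    rw [← Int.cast_mul, ← Units.val_mul, Int.units_mul_self]; simp
  ext i j
  rw [Matrix.sum_apply]
  simp only [Matrix.mul_diagonal, Matrix.diagonal_mul, Matrix.smul_apply, smul_eq_mul]
  by_cases hij : i = j
  · subst hij
    rw [Matrix.diagonal_apply_eq]
    rw [Finset.sum_congr rfl (g := fun _ => M i i)]
    · simp
    · intro ε _
      have := hsq (ε i)
      linear_combination M i i * this
  · rw [Matrix.diagonal_apply_ne _ hij, mul_zero]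
    set S := ∑ ε : Fin n → ℤˣ, (((ε i : ℤˣ) : ℤ) : ℂ) * M i j * (((ε j : ℤˣ) : ℤ) : ℂ) with hS
    have h1 : S = -S := by
      conv_lhs => rw [hS]
      rw [← Equiv.sum_comp (Equiv.mulLeft (Pi.mulSingle i (-1 : ℤˣ) : Fin n → ℤˣ)), hS,
        ← Finset.sum_neg_distrib]
      apply Finset.sum_congr rfl
      intro ε _
      have hji : j ≠ i := fun h => hij h.symm
      simp [Pi.mulSingle_eq_of_ne hji]
    exact self_eq_neg.mp h1

variable (N : Matrix (Fin n) (Fin n) ℂ → ℝ)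
    (hN0 : ∀ A : Matrix (Fin n) (Fin n) ℂ, N A = 0 ↔ A = 0)
    (hNs : ∀ (c : ℂ) (A : Matrix (Fin n) (Fin n) ℂ), N (c • A) = ‖c‖ * N A)
    (hNa : ∀ A B : Matrix (Fin n) (Fin n) ℂ, N (A + B) ≤ N A + N B)
    (hUI : ∀ U V A : Matrix (Fin n) (Fin n) ℂ, U ∈ Matrix.unitaryGroup (Fin n) ℂ →
      V ∈ Matrix.unitaryGroup (Fin n) ℂ → N (U * A * V) = N A)

include hN0 hNs hNa

lemma N_nonneg (A : Mn) : 0 ≤ N A := by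
  have h1 := hNa A ((-1 : ℂ) • A)
  rw [hNs] at h1
  have : A + (-1 : ℂ) • A = 0 := by simp
  rw [this, (hN0 0).mpr rfl] at h1
  simp at h1
  linarith

include hUI

lemma N_pinch (M : Mn) : N (Matrix.diagonal (fun i => M i i)) ≤ N M := by
  have hsq : ∀ u : ℤˣ, ((u : ℤ) : ℂ) * ((u : ℤ) : ℂ) = 1 := by
    intro u
    rw [← Int.cast_mul, ← Units.val_mul, Int.units_mul_self]; simp
  have h1 := congrArg N (pinch_avg M)
  rw [hNs] at h1
  have h2 : ∀ (s : Finset (Fin n → ℤˣ)) (f : (Fin n → ℤˣ) → Mn), N (∑ e ∈ s, f e) ≤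
      ∑ e ∈ s, N (f e) := by
    intro s f
    induction s using Finset.cons_induction with
    | empty => simp [(hN0 0).mpr rfl]
    | cons a s ha ih =>
      rw [Finset.sum_cons, Finset.sum_cons]
      exact (hNa _ _).trans (by linarith)
  have h3 := h2 Finset.univ (fun ε => Matrix.diagonal (fun i => (((ε i : ℤˣ) : ℤ) : ℂ)) * M *
      Matrix.diagonal (fun i => (((ε i : ℤˣ) : ℤ) : ℂ)))
  rw [h1] at h3
  have h4 : ∀ ε : Fin n → ℤˣ, Matrix.diagonal (fun i => (((ε i : ℤˣ) : ℤ) : ℂ)) ∈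
      Matrix.unitaryGroup (Fin n) ℂ := fun ε => diag_unitary _ (fun i => by simpa using hsq (ε i))
  simp only [hUI _ _ _ (h4 _) (h4 _)] at h3
  rw [Finset.sum_const, nsmul_eq_mul, Complex.norm_natCast, Finset.card_univ] at h3
  have hc : (0 : ℝ) < (Fintype.card (Fin n → ℤˣ) : ℝ) := by
    exact_mod_cast Fintype.card_pos
  exact le_of_mul_le_mul_left h3 hc

lemma N_diag_mono (s t : Fin n → ℝ) (hs : ∀ i, 0 ≤ s i) (hst : ∀ i, s i ≤ t i) :
    N (Matrix.diagonal (fun i => (s i : ℂ))) ≤ N (Matrix.diagonal (fun i => (t i : ℂ))) := by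
  set c : Fin n → ℝ := fun i => s i / t i with hc
  have hc0 : ∀ i, 0 ≤ c i := fun i => div_nonneg (hs i) ((hs i).trans (hst i))
  have hc1 : ∀ i, c i ≤ 1 := fun i => div_le_one_of_le₀ (hst i) ((hs i).trans (hst i))
  have hct : ∀ i, c i * t i = s i := by
    intro i
    by_cases h : t i = 0
    · have := hs i
      have := hst i
      rw [h, mul_zero]; linarith
    · simp [hc, h]
  set u : Fin n → ℂ := fun i => ⟨c i, Real.sqrt (1 - c i ^ 2)⟩ with hu
  have hu1 : ∀ i, u i * star (u i) = 1 := by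
    intro i
    rw [Complex.star_def, Complex.mul_conj, Complex.normSq_mk, Real.mul_self_sqrt]
    · simp; ring
    · nlinarith [hc0 i, hc1 i]
  have hu2 : ∀ i, star (u i) * star (star (u i)) = 1 := by
    intro i; rw [star_star, mul_comm]; exact hu1 i
  have hdec : Matrix.diagonal (fun i => (s i : ℂ)) = (1 / 2 : ℂ) •
      (Matrix.diagonal u * Matrix.diagonal (fun i => (t i : ℂ)) * 1 +
       Matrix.diagonal (fun i => star (u i)) * Matrix.diagonal (fun i => (t i : ℂ)) * 1) := by
    rw [mul_one, mul_one, Matrix.diagonal_mul_diagonal, Matrix.diagonal_mul_diagonal,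
      Matrix.diagonal_add, ← Matrix.diagonal_smul]
    congr 1
    ext i
    have h1 : u i + star (u i) = 2 * (c i : ℂ) := by
      rw [Complex.star_def, Complex.add_conj]; simp [hu]
    have h2 : (c i : ℂ) * t i = s i := by exact_mod_cast hct i
    simp only [Pi.smul_apply, smul_eq_mul]
    linear_combination (-1 / 2 * (t i : ℂ)) * h1 - h2
  have e1 := hUI _ _ (Matrix.diagonal (fun i => (t i : ℂ))) (diag_unitary u hu1) (one_mem _)
  have e2 := hUI _ _ (Matrix.diagonal (fun i => (t i : ℂ)))
    (diag_unitary (fun i => star (u i)) hu2) (one_mem _)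
  have h3 := hNa (Matrix.diagonal u * Matrix.diagonal (fun i => (t i : ℂ)) * 1)
    (Matrix.diagonal (fun i => star (u i)) * Matrix.diagonal (fun i => (t i : ℂ)) * 1)
  rw [hdec, hNs]
  rw [e1, e2] at h3
  have : ‖(1 / 2 : ℂ)‖ = 1 / 2 := by norm_num
  rw [this]
  linarith

lemma N_sector {X : Mn} {α : ℝ} (hα0 : 0 ≤ α) (hα1 : α < Real.pi / 2)
    (hX : numRange X ⊆ sector α) : N X ≤ (Real.cos α)⁻¹ * N (matRe X) := by
  obtain ⟨P, hP, Q, hQ, s, hs, hPXQ⟩ := svd_inv X (unit_of_sector hX)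
  have hcos : 0 < Real.cos α := Real.cos_pos_of_mem_Ioo ⟨by linarith [Real.pi_pos], hα1⟩
  have hPs : Pᴴ ∈ Matrix.unitaryGroup (Fin n) ℂ := Unitary.star_mem hP
  have hQs : Qᴴ ∈ Matrix.unitaryGroup (Fin n) ℂ := Unitary.star_mem hQ
  have hent : ∀ (R S Y : Mn) (i : Fin n), (R * Y * S) i i =
      sform Y (Rᴴ.mulVec (Pi.single i 1)) (S.mulVec (Pi.single i 1)) := by
    intro R S Y i
    rw [sform, Matrix.star_mulVec, Matrix.conjTranspose_conjTranspose, Matrix.mulVec_mulVec,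
      ← Matrix.dotProduct_mulVec, Matrix.mulVec_mulVec, ← Matrix.mul_assoc]
    simp [← Pi.single_star]
  set A := matRe X with hA
  set d1 : Fin n → ℝ := fun i => ((P * A * Pᴴ) i i).re with hd1
  set d2 : Fin n → ℝ := fun i => ((Qᴴ * A * Q) i i).re with hd2
  have hbound : ∀ i, s i ≤ (Real.cos α)⁻¹ * ((1 / 2) * (d1 i + d2 i)) := by
    intro i
    have h1 : s i = ((P * X * Q) i i).re := by rw [hPXQ]; simp
    rw [h1, hd1, hd2]
    simp only [hent, Matrix.conjTranspose_conjTranspose]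
    exact sector_form_bound hα0 hα1 hX _ _
  have hreal1 : ∀ i, ((d1 i : ℝ) : ℂ) = (P * A * Pᴴ) i i := by
    intro i
    have := sform_herm_im (matRe_herm X) (Pᴴ.mulVec (Pi.single i 1))
    rw [← hent] at this
    apply Complex.ext <;> simp [hd1]
    exact this.symm
  have hreal2 : ∀ i, ((d2 i : ℝ) : ℂ) = (Qᴴ * A * Q) i i := by
    intro i
    have := sform_herm_im (matRe_herm X) (Q.mulVec (Pi.single i 1))
    have h2 := hent Qᴴ Q A i
    rw [Matrix.conjTranspose_conjTranspose] at h2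
    rw [← h2] at this
    apply Complex.ext <;> simp [hd2]
    exact this.symm
  have hmono := N_diag_mono N hN0 hNs hNa hUI s _ hs hbound
  rw [← hPXQ, hUI _ _ _ hP hQ] at hmono
  have hD : Matrix.diagonal (fun i => (((Real.cos α)⁻¹ * ((1 / 2) * (d1 i + d2 i)) : ℝ) : ℂ)) =
      (((Real.cos α)⁻¹ * (1 / 2) : ℝ) : ℂ) •
        (Matrix.diagonal (fun i => (P * A * Pᴴ) i i) +
          Matrix.diagonal (fun i => (Qᴴ * A * Q) i i)) := by
    rw [Matrix.diagonal_add, ← Matrix.diagonal_smul]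
    congr 1
    ext i
    simp only [Pi.smul_apply, smul_eq_mul, ← hreal1, ← hreal2]
    push_cast
    ring
  rw [hD, hNs, Complex.norm_real, Real.norm_of_nonneg (by positivity)] at hmono
  have h1 := N_pinch N hN0 hNs hNa hUI (P * A * Pᴴ)
  have h2 := N_pinch N hN0 hNs hNa hUI (Qᴴ * A * Q)
  rw [hUI _ _ _ hP hPs] at h1
  rw [hUI _ _ _ hQs hQ] at h2
  have h3 := hNa (Matrix.diagonal (fun i => (P * A * Pᴴ) i i))
    (Matrix.diagonal (fun i => (Qᴴ * A * Q) i i))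
  calc N X ≤ _ := hmono
    _ ≤ (Real.cos α)⁻¹ * (1 / 2) * (N A + N A) := by gcongr; linarith
    _ = _ := by ring

omit hN0 hNs hNa in
lemma N_star {X : Mn} (hX : X.det ≠ 0) : N Xᴴ = N X := by
  obtain ⟨P, hP, Q, hQ, s, hs, h⟩ := svd_inv X hX
  have hPs : Pᴴ ∈ Matrix.unitaryGroup (Fin n) ℂ := Unitary.star_mem hP
  have hQs : Qᴴ ∈ Matrix.unitaryGroup (Fin n) ℂ := Unitary.star_mem hQ
  rw [← hUI P Q X hP hQ, ← hUI Qᴴ Pᴴ Xᴴ hQs hPs]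
  have : Qᴴ * Xᴴ * Pᴴ = (P * X * Q)ᴴ := by
    simp [Matrix.conjTranspose_mul, Matrix.mul_assoc]
  rw [this, h, Matrix.diagonal_conjTranspose]
  congr 2
  ext i
  simp

omit hN0 hUI in
lemma N_re_bound (X : Mn) (θ : ℝ) :
    N (matRe (Complex.exp (θ * Complex.I) • X)) ≤ (1 / 2) * (N X + N Xᴴ) := by
  unfold matRe
  rw [hNs, Matrix.conjTranspose_smul]
  have h := hNa (Complex.exp (θ * Complex.I) • X) (star (Complex.exp (θ * Complex.I)) • Xᴴ)
  rw [hNs, hNs, norm_star, Complex.norm_exp_ofReal_mul_I, one_mul, one_mul] at h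
  have : ‖(1 / 2 : ℂ)‖ = 1 / 2 := by norm_num
  rw [this]
  linarith

omit hN0 in
lemma gnr_le {X : Mn} (hX : X.det ≠ 0) : gnr N X ≤ N X := by
  apply ciSup_le
  intro θ
  have := N_re_bound N hNs hNa X θ
  rw [N_star N hUI hX] at this
  linarith

omit hN0 hUI in
lemma le_gnr (X : Mn) (θ : ℝ) :
    N (matRe (Complex.exp (θ * Complex.I) • X)) ≤ gnr N X := by
  apply le_ciSup (f := fun θ : ℝ => N (matRe (Complex.exp (θ * Complex.I) • X)))
  refine ⟨(1 / 2) * (N X + N Xᴴ), ?_⟩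
  rintro _ ⟨θ, rfl⟩
  exact N_re_bound N hNs hNa X θ

lemma N_le_gnr {X : Mn} {α : ℝ} (hα0 : 0 ≤ α) (hα1 : α < Real.pi / 2)
    (hX : X ∈ sectClass n α) : N X ≤ (Real.cos α)⁻¹ * gnr N X := by
  obtain ⟨z, hz, hs⟩ := hX
  have hcos : 0 < Real.cos α := Real.cos_pos_of_mem_Ioo ⟨by linarith [Real.pi_pos], hα1⟩
  have h1 := N_sector N hN0 hNs hNa hUI hα0 hα1 hs
  rw [hNs, hz, one_mul] at h1
  have hz' : z = Complex.exp ((Complex.arg z : ℝ) * Complex.I) := by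
    have := Complex.norm_mul_exp_arg_mul_I z
    rw [hz] at this
    simpa using this.symm
  have h2 := le_gnr N hNs hNa X (Complex.arg z)
  rw [← hz'] at h2
  exact h1.trans (by gcongr)

end helpers

lemma det_of_sectClass {n : ℕ} {α : ℝ} {X : Matrix (Fin n) (Fin n) ℂ}
    (hX : X ∈ sectClass n α) : X.det ≠ 0 := by
  obtain ⟨z, hz, hs⟩ := hX
  have := unit_of_sector hs
  rw [Matrix.det_smul] at this
  exact right_ne_zero_of_mul this

lemma N_prod_le {n : ℕ} (N : Matrix (Fin n) (Fin n) ℂ → ℝ) (hnn : ∀ A, 0 ≤ N A)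
    (hSM : ∀ A B : Matrix (Fin n) (Fin n) ℂ, N (A * B) ≤ N A * N B) :
    ∀ (m : ℕ) (X : Fin (m + 1) → Matrix (Fin n) (Fin n) ℂ),
      N (List.ofFn X).prod ≤ ∏ j, N (X j) := by
  intro m
  induction m with
  | zero => intro X; simp
  | succ k ih =>
    intro X
    rw [List.ofFn_succ, List.prod_cons, Fin.prod_univ_succ]
    exact (hSM _ _).trans (mul_le_mul_of_nonneg_left (ih _) (hnn _))

theorem stmt_7 {n : ℕ} (N : Matrix (Fin n) (Fin n) ℂ → ℝ)
    (hN0 : ∀ A : Matrix (Fin n) (Fin n) ℂ, N A = 0 ↔ A = 0)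
    (hNs : ∀ (c : ℂ) (A : Matrix (Fin n) (Fin n) ℂ), N (c • A) = ‖c‖ * N A)
    (hNa : ∀ A B : Matrix (Fin n) (Fin n) ℂ, N (A + B) ≤ N A + N B)
    (hUI : ∀ U V A : Matrix (Fin n) (Fin n) ℂ, U ∈ Matrix.unitaryGroup (Fin n) ℂ →
      V ∈ Matrix.unitaryGroup (Fin n) ℂ → N (U * A * V) = N A)
    (hSM : ∀ A B : Matrix (Fin n) (Fin n) ℂ, N (A * B) ≤ N A * N B)
    {m : ℕ} (hm : 1 ≤ m) {α : ℝ} (hα0 : 0 ≤ α) (hα1 : α < Real.pi / 2)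
    (X : Fin m → Matrix (Fin n) (Fin n) ℂ)
    (hX : ∀ j, X j ∈ sectClass n α) :
    gnr N (List.ofFn X).prod ≤ ((Real.cos α)⁻¹) ^ m * ∏ j, gnr N (X j) := by
  have hnn := N_nonneg N hN0 hNs hNa
  have hdet : (List.ofFn X).prod.det ≠ 0 := by
    have h1 : (List.ofFn X).prod.det = ((List.ofFn X).map Matrix.det).prod :=
      map_list_prod Matrix.detMonoidHom _
    rw [h1]
    apply List.prod_ne_zero
    intro h0
    simp only [List.mem_map, List.mem_ofFn, Set.mem_range] at h0
    obtain ⟨_, ⟨j, rfl⟩, hj⟩ := h0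
    exact det_of_sectClass (hX j) hj
  refine (gnr_le N hNs hNa hUI hdet).trans ?_
  obtain ⟨k, rfl⟩ : ∃ k, m = k + 1 := ⟨m - 1, by omega⟩
  refine (N_prod_le N hnn hSM k X).trans ?_
  calc ∏ j, N (X j) ≤ ∏ j, ((Real.cos α)⁻¹ * gnr N (X j)) :=
        Finset.prod_le_prod (fun j _ => hnn _)
          (fun j _ => N_le_gnr N hN0 hNs hNa hUI hα0 hα1 (hX j))
    _ = _ := by rw [Finset.prod_mul_distrib]; simp
end
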